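/- arXiv:1503.04323 — 2 statements merged into one kernel-verified Lean document; each statement's English description precedes it below -/
import Mathlib

section
/- Let n ≥ 1, s ≥ 1, and s₁, s₂ > 0 with 1 ≤ s₁ < n/2 + 1 and s₁ + s₂ = s + n/2 + 1. There exists a constant c > 0 (depending only on n, s, s₁, s₂ and φ) such that for all Schwartz vector fields u, B : ℝⁿ → ℝⁿ, Σ_{j∈ℤ} ‖Λ^s[((Σ_{i=j−9}^{j+9} Δ_i u)·∇)Δ_j B] − ((Σ_{i=j−9}^{j+9} Δ_i u)·∇)(Λ^s Δ_j B)‖²_{L²} ≤ c·‖u‖²_{Ḣ^{s₁}}·‖B‖²_{Ḣ^{s₂}}. -/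
open MeasureTheory Filter SchwartzMap
open scoped FourierTransform

noncomputable section

abbrev Ell (n : ℕ) := EuclideanSpace ℝ (Fin n)

def eVec (n : ℕ) (i : Fin n) : Ell n := EuclideanSpace.single i 1

/-- coercion of a real-valued function to a complex-valued one -/
def cf {n : ℕ} (f : Ell n → ℝ) : Ell n → ℂ := fun x => (f x : ℂ)

/-- the Fourier multiplier operator `Λ^s` with symbol `|ξ|^s` -/
def Lam {n : ℕ} (s : ℝ) (f : Ell n → ℂ) : Ell n → ℂ :=
  𝓕⁻ (fun ξ => ((‖ξ‖ ^ s : ℝ) : ℂ) * 𝓕 f ξ)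

/-- the partial derivative `∂ᵢ` -/
def pd {n : ℕ} (i : Fin n) (f : Ell n → ℂ) : Ell n → ℂ :=
  fun x => fderiv ℝ f x (eVec n i)

/-- the advection term `(v·∇)w` for complex vector fields -/
def adv {n : ℕ} (v w : Fin n → Ell n → ℂ) : Fin n → Ell n → ℂ :=
  fun l x => ∑ i, v i x * pd i (w l) x

/-- squared homogeneous Sobolev norm of a complex scalar function -/
def HsqC {n : ℕ} (s : ℝ) (f : Ell n → ℂ) : ℝ :=
  ∫ ξ, ‖ξ‖ ^ (2 * s) * ‖𝓕 f ξ‖ ^ 2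

/-- homogeneous Sobolev norm `‖u‖_{Ḣ^s}` of a real vector field -/
def Hnorm {n : ℕ} (s : ℝ) (u : Fin n → Ell n → ℝ) : ℝ :=
  Real.sqrt (∑ l, HsqC s (cf (u l)))

/-- `L²` norm of a complex vector field -/
def vL2 {n : ℕ} (f : Fin n → Ell n → ℂ) : ℝ :=
  Real.sqrt (∑ l, ∫ x, ‖f l x‖ ^ 2)

/-- `L²` pairing `⟨f,g⟩ = Σ_l ∫ f_l g_l` of complex vector fields -/
def Cinner {n : ℕ} (f g : Fin n → Ell n → ℂ) : ℂ :=
  ∑ l, ∫ x, f l x * g l x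

/-- The standing assumptions on the Littlewood–Paley function `φ`: a smooth,
radial, compactly supported function with values in `[0,1]`, supported in the
annulus `{3/4 ≤ |ξ| ≤ 8/3}`, with `Σ_{j∈ℤ} φ(2^{−j}ξ) = 1` for `ξ ≠ 0` and
`φ(2^{−j}·), φ(2^{−j'}·)` having disjoint supports when `|j−j'| ≥ 2`. -/
def LPFunction {n : ℕ} (φ : Ell n → ℝ) : Prop :=
  ContDiff ℝ (⊤ : ℕ∞) φ ∧ HasCompactSupport φ ∧
  (∀ ξ, φ ξ ≠ 0 → 3 / 4 ≤ ‖ξ‖ ∧ ‖ξ‖ ≤ 8 / 3) ∧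
  (∀ ξ, φ ξ ∈ Set.Icc (0 : ℝ) 1) ∧
  (∀ ξ η : Ell n, ‖ξ‖ = ‖η‖ → φ ξ = φ η) ∧
  (∀ ξ : Ell n, ξ ≠ 0 → (∑' j : ℤ, φ ((2 : ℝ) ^ (-j) • ξ)) = 1) ∧
  (∀ j j' : ℤ, 2 ≤ |j - j'| → ∀ ξ : Ell n,
    φ ((2 : ℝ) ^ (-j) • ξ) * φ ((2 : ℝ) ^ (-j') • ξ) = 0)

/-- the homogeneous dyadic block `Δ_j u = 𝓕⁻¹(φ(2^{−j}ξ) û(ξ))` -/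
def DeltaJ {n : ℕ} (φ : Ell n → ℝ) (j : ℤ) (f : Ell n → ℂ) : Ell n → ℂ :=
  𝓕⁻ (fun ξ => ((φ ((2 : ℝ) ^ (-j) • ξ) : ℝ) : ℂ) * 𝓕 f ξ)

/-- the homogeneous cutoff `Ṡ_j u = Σ_{j' ≤ j−1} Δ_{j'} u` -/
def SJ {n : ℕ} (φ : Ell n → ℝ) (j : ℤ) (f : Ell n → ℂ) : Ell n → ℂ :=
  fun x => ∑' j' : ℤ, if j' ≤ j - 1 then DeltaJ φ j' f x else 0

/-- `L²` norm of `Δ_j u` for a real vector field `u` -/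
def DeltaL2 {n : ℕ} (φ : Ell n → ℝ) (j : ℤ) (u : Fin n → Ell n → ℝ) : ℝ :=
  Real.sqrt (∑ l, ∫ x, ‖DeltaJ φ j (cf (u l)) x‖ ^ 2)

/-- the homogeneous Besov norm `‖u‖_{Ḃ^s_{2,1}} = Σ_{j∈ℤ} 2^{js} ‖Δ_j u‖_{L²}` -/
def Bnorm {n : ℕ} (φ : Ell n → ℝ) (s : ℝ) (u : Fin n → Ell n → ℝ) : ℝ :=
  ∑' j : ℤ, (2 : ℝ) ^ ((j : ℝ) * s) * DeltaL2 φ j u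

section FourierLemmas

variable {V : Type*} [NormedAddCommGroup V] [InnerProductSpace ℝ V] [FiniteDimensional ℝ V]
  [MeasurableSpace V] [BorelSpace V]

/-- The inverse Fourier integral is self-transposed, tested against a Schwartz function. -/
theorem integral_smul_fourierInv_eq (g : 𝓢(V, ℂ)) {h : V → ℂ} (hh : Integrable h) :
    ∫ x, g x • 𝓕⁻ h x = ∫ x, (𝓕⁻ g) x • h x := by
  have key := VectorFourier.integral_fourierIntegral_smul_eq_flip (μ := (volume : Measure V))
    (ν := (volume : Measure V)) (L := -innerₗ V) (f := (g : V → ℂ)) (g := h)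
    Real.continuous_fourierChar (by simpa using continuous_inner.fun_neg) g.integrable hh
  have e1 : ∀ f : V → ℂ, VectorFourier.fourierIntegral Real.fourierChar volume (-innerₗ V) f
      = 𝓕⁻ f := by
    intro f
    ext x
    simp [VectorFourier.fourierIntegral, Real.fourierInv_eq]
  have e2 : (-innerₗ V).flip = -innerₗ V := by
    ext x y
    simp [real_inner_comm]
  rw [e2, e1, e1] at key
  rw [SchwartzMap.fourierInv_coe]
  exact key.symm

/-- The `L²` inverse Fourier transform of an integrable function is given by the integral. -/
theorem coeFn_fourierInv_toLp_ae_eq {h : V → ℂ} (h1 : Integrable h) (h2 : MemLp h 2) :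
    (𝓕⁻ (h2.toLp h) : Lp (α := V) ℂ 2 volume) =ᵐ[volume] 𝓕⁻ h := by
  have hcont : Continuous (𝓕⁻ h) := by
    have : (𝓕⁻ h) = fun x => 𝓕 h (-x) := by ext x; exact Real.fourierInv_eq_fourier_neg h x
    rw [this]
    exact (VectorFourier.fourierIntegral_continuous Real.continuous_fourierChar
      (by exact continuous_inner) h1).comp continuous_neg
  apply ae_eq_of_integral_contDiff_smul_eq
  · exact (Lp.memLp _).locallyIntegrable (by norm_num)
  · exact hcont.locallyIntegrable
  intro g hg hgs
  let G : 𝓢(V, ℂ) := HasCompactSupport.toSchwartzMap (f := fun x => (g x : ℂ))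
    (hgs.comp_left (g := fun t : ℝ => (t : ℂ)) (by simp))
    (Complex.ofRealCLM.contDiff.comp hg)
  have e3 := congrArg (fun T => T G) (Lp.fourierInv_toTemperedDistribution_eq (h2.toLp h))
  simp only [TemperedDistribution.fourierInv_apply, Lp.toTemperedDistribution_apply] at e3
  have e4 : ∫ x, (𝓕⁻ G) x • (h2.toLp h : V → ℂ) x = ∫ x, (𝓕⁻ G) x • h x := by
    apply integral_congr_ae
    filter_upwards [h2.coeFn_toLp] with x hx
    rw [hx]
  rw [e4, ← integral_smul_fourierInv_eq G h1] at e3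
  have e5 : ∀ x, G x = (g x : ℂ) := fun _ => rfl
  simpa only [e5, Complex.coe_smul, smul_eq_mul, Complex.real_smul] using e3.symm

/-- Plancherel's theorem for functions in `L¹ ∩ L²`. -/
theorem memLp_fourierInv_of_integrable {h : V → ℂ} (h1 : Integrable h) (h2 : MemLp h 2) :
    MemLp (𝓕⁻ h) 2 volume ∧ ∫ x, ‖𝓕⁻ h x‖ ^ 2 = ∫ x, ‖h x‖ ^ 2 := by
  have hae := coeFn_fourierInv_toLp_ae_eq h1 h2
  have hm : MemLp (𝓕⁻ h) 2 volume := (memLp_congr_ae hae).1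
    (Lp.memLp (𝓕⁻ (h2.toLp h) : Lp (α := V) ℂ 2 volume))
  refine ⟨hm, ?_⟩
  have hn : ‖(𝓕⁻ (h2.toLp h) : Lp (α := V) ℂ 2 volume)‖ = ‖h2.toLp h‖ :=
    (Lp.fourierTransformₗᵢ V ℂ).symm.norm_map _
  have e : ∀ f : Lp (α := V) ℂ 2 volume, ‖f‖ ^ 2 = ∫ x, ‖f x‖ ^ 2 := by
    intro f
    have := L2.inner_def (𝕜 := ℂ) f f
    rw [inner_self_eq_norm_sq_to_K] at this
    apply Complex.ofRealLI.injective
    simpa [← LinearIsometry.integral_comp_comm, inner_self_eq_norm_sq_to_K] using this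
  have := congrArg (· ^ 2) hn
  simp only [e] at this
  rw [integral_congr_ae (g := fun x => ‖𝓕⁻ h x‖ ^ 2)] at this
  · rw [this]
    apply integral_congr_ae
    filter_upwards [h2.coeFn_toLp] with x hx
    rw [hx]
  · filter_upwards [hae] with x hx
    rw [hx]

/-- The spectrum of a product of Schwartz functions lies in the sum of the spectra. -/
theorem norm_le_of_fourier_mul_ne_zero (f g : 𝓢(V, ℂ)) {r₁ r₂ : ℝ}
    (hf : ∀ ξ, 𝓕 f ξ ≠ 0 → ‖ξ‖ ≤ r₁) (hg : ∀ ξ, 𝓕 g ξ ≠ 0 → ‖ξ‖ ≤ r₂) (ξ : V)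
    (hξ : 𝓕 (fun x => f x * g x) ξ ≠ 0) : ‖ξ‖ ≤ r₁ + r₂ := by
  have neg : ∀ k : V → ℂ, ∀ x, 𝓕 k x = 𝓕⁻ k (-x) := by
    intro k x
    rw [Real.fourierInv_eq_fourier_neg, neg_neg]
  let B := ContinuousLinearMap.mul ℂ ℂ
  have hp : (fun x => f x * g x) = (pairing B f g : V → ℂ) := by
    ext x; simp [B]
  have hc : SchwartzMap.convolution B (𝓕⁻ f) (𝓕⁻ g) = 𝓕⁻ (pairing B f g) := by
    have := fourier_convolution B (𝓕⁻ f) (𝓕⁻ g)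
    simp only [FourierTransform.fourier_fourierInv_eq] at this
    rw [← this, FourierTransform.fourierInv_fourier_eq]
  rw [hp, neg, ← SchwartzMap.fourierInv_coe, ← hc, SchwartzMap.convolution_apply] at hξ
  obtain ⟨y, hy, z, hz, hyz⟩ := support_convolution_subset _ hξ
  have h1 : ‖y‖ ≤ r₁ := by
    rw [← norm_neg]
    apply hf
    rwa [SchwartzMap.fourier_coe, neg, neg_neg, ← SchwartzMap.fourierInv_coe]
  have h2 : ‖z‖ ≤ r₂ := by
    rw [← norm_neg]
    apply hg
    rwa [SchwartzMap.fourier_coe, neg, neg_neg, ← SchwartzMap.fourierInv_coe]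
  rw [← norm_neg, ← hyz]
  exact (norm_add_le _ _).trans (add_le_add h1 h2)

theorem SchwartzMap.integral_norm_sq_fourierInv (f : 𝓢(V, ℂ)) :
    ∫ x, ‖𝓕⁻ f x‖ ^ 2 = ∫ ξ, ‖f ξ‖ ^ 2 := by
  rw [← integral_norm_sq_fourier, FourierTransform.fourier_fourierInv_eq]

theorem SchwartzMap.integrable_norm_sq (f : 𝓢(V, ℂ)) : Integrable fun x => ‖f x‖ ^ 2 :=
  (memLp_two_iff_integrable_sq_norm f.continuous.aestronglyMeasurable).1 (f.memLp 2)

/-- Bernstein's inequality: `L²` to `L^∞` for functions with bounded spectrum. -/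
theorem norm_fourierInv_sq_le (a : 𝓢(V, ℂ)) {r : ℝ} (ha : ∀ ξ, a ξ ≠ 0 → ‖ξ‖ ≤ r) (x : V) :
    ‖𝓕⁻ a x‖ ^ 2 ≤ volume.real (Metric.closedBall (0 : V) r) * ∫ ξ, ‖a ξ‖ ^ 2 := by
  set S := Metric.closedBall (0 : V) r
  have hfin : volume S ≠ ⊤ := measure_closedBall_lt_top.ne
  have h1 : ‖𝓕⁻ a x‖ ≤ ∫ ξ, ‖a ξ‖ := by
    rw [SchwartzMap.fourierInv_coe, Real.fourierInv_eq]
    refine (norm_integral_le_integral_norm _).trans_eq ?_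
    simp [Circle.norm_smul]
  have h2 : ∫ ξ, ‖a ξ‖ = ∫ ξ, S.indicator (fun _ => (1 : ℝ)) ξ * ‖a ξ‖ := by
    congr 1
    ext ξ
    by_cases h : ξ ∈ S
    · simp [h]
    · have : a ξ = 0 := by
        by_contra h'
        exact h (by simpa [S] using ha ξ h')
      simp [this]
  have h3 := integral_mul_le_Lp_mul_Lq_of_nonneg (μ := (volume : Measure V))
    (f := S.indicator (fun _ => (1 : ℝ))) (g := fun ξ => ‖a ξ‖) Real.HolderConjugate.two_two
    (ae_of_all _ fun ξ => Set.indicator_nonneg (by simp) _) (ae_of_all _ fun ξ => norm_nonneg _)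
    (memLp_indicator_const _ Metric.isClosed_closedBall.measurableSet _ (Or.inr hfin))
    (by simpa using (a.memLp 2).norm)
  have h4 : ∫ ξ, S.indicator (fun _ => (1 : ℝ)) ξ ^ (2 : ℝ) = volume.real S := by
    rw [← integral_indicator_one (s := S) Metric.isClosed_closedBall.measurableSet]
    congr 1
    ext ξ
    by_cases h : ξ ∈ S <;> simp [h]
  rw [h4, ← h2] at h3
  simp only [Real.rpow_two, ← Real.sqrt_eq_rpow] at h3
  calc ‖𝓕⁻ a x‖ ^ 2 ≤ (√(volume.real S) * √(∫ ξ, ‖a ξ‖ ^ 2)) ^ 2 := by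
        gcongr
        exact h1.trans h3
    _ = _ := by
        rw [mul_pow, Real.sq_sqrt measureReal_nonneg,
          Real.sq_sqrt (integral_nonneg fun _ => by positivity)]

/-- Bernstein's inequality for first derivatives in `L²`. -/
theorem integral_norm_sq_lineDeriv_fourierInv_le (b : 𝓢(V, ℂ)) {r : ℝ}
    (hb : ∀ ξ, b ξ ≠ 0 → ‖ξ‖ ≤ r) (m : V) (hm : ‖m‖ = 1) :
    ∫ x, ‖(LineDeriv.lineDerivOp m (𝓕⁻ b) : 𝓢(V, ℂ)) x‖ ^ 2
      ≤ (2 * Real.pi * r) ^ 2 * ∫ ξ, ‖b ξ‖ ^ 2 := by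
  rw [lineDerivOp_fourierInv_eq, SchwartzMap.integral_norm_sq_fourierInv, ← integral_const_mul]
  apply integral_mono (SchwartzMap.integrable_norm_sq _) (b.integrable_norm_sq.const_mul _)
  intro ξ
  have hg : (fun ξ : V => inner ℝ ξ m).HasTemperateGrowth := by fun_prop
  simp only [smul_apply, smulLeftCLM_apply_apply hg, norm_smul, norm_mul, Complex.norm_real,
    Complex.norm_I, Complex.norm_ofNat, mul_one]
  by_cases h : b ξ = 0
  · simp [h]
  · have h1 : ‖inner ℝ ξ m‖ ≤ r := (norm_inner_le_norm ξ m).trans (by simpa [hm] using hb ξ h)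
    rw [Real.norm_of_nonneg Real.pi_pos.le, ← mul_assoc, mul_pow]
    gcongr

end FourierLemmas
/-- `Λ^s` is bounded in `L²` on Schwartz functions with bounded spectrum. -/
theorem memLp_Lam_of_fourier_support {n : ℕ} {s : ℝ} (hs : 0 ≤ s) (g : 𝓢(Ell n, ℂ)) {r : ℝ}
    (hg : ∀ ξ, 𝓕 g ξ ≠ 0 → ‖ξ‖ ≤ r) :
    MemLp (Lam s g) 2 volume ∧ ∫ x, ‖Lam s g x‖ ^ 2 ≤ r ^ (2 * s) * ∫ x, ‖g x‖ ^ 2 := by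
  have hcont : Continuous fun ξ : Ell n => ((‖ξ‖ ^ s : ℝ) : ℂ) * 𝓕 g ξ :=
    (Complex.continuous_ofReal.comp
      (continuous_norm.rpow_const fun _ => Or.inr hs)).mul (𝓕 g).continuous
  have hsupp : HasCompactSupport fun ξ : Ell n => ((‖ξ‖ ^ s : ℝ) : ℂ) * 𝓕 g ξ := by
    apply HasCompactSupport.intro (isCompact_closedBall (0 : Ell n) r)
    intro ξ hξ
    have : 𝓕 g ξ = 0 := by
      by_contra h
      exact hξ (by simpa using hg ξ h)
    simp [this]
  obtain ⟨h1, h2⟩ := memLp_fourierInv_of_integrable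
    (hcont.integrable_of_hasCompactSupport hsupp) (hcont.memLp_of_hasCompactSupport hsupp)
  refine ⟨h1, ?_⟩
  change ∫ x, ‖𝓕⁻ (fun ξ : Ell n => ((‖ξ‖ ^ s : ℝ) : ℂ) * 𝓕 g ξ) x‖ ^ 2 ≤ _
  rw [h2, ← SchwartzMap.integral_norm_sq_fourier g, ← integral_const_mul]
  apply integral_mono_of_nonneg (ae_of_all _ fun _ => by positivity)
    ((SchwartzMap.integrable_norm_sq _).const_mul _) (ae_of_all _ fun ξ => ?_)
  simp only [norm_mul, mul_pow, Complex.norm_real]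
  by_cases h : 𝓕 g ξ = 0
  · simp [h]
  · have := hg ξ h
    rw [Real.norm_of_nonneg (by positivity), ← Real.rpow_natCast, ← Real.rpow_mul (norm_nonneg _),
      mul_comm s]
    push_cast
    gcongr

/-- The Schwartz function `Σᵢ vᵢ ∂ᵢ w` with `v̂ᵢ = Aᵢ` and `ŵ = b`. -/
def advSchwartz {n : ℕ} (A : Fin n → 𝓢(Ell n, ℂ)) (b : 𝓢(Ell n, ℂ)) : 𝓢(Ell n, ℂ) :=
  ∑ i, pairing (ContinuousLinearMap.mul ℂ ℂ) (𝓕⁻ (A i)) (LineDeriv.lineDerivOp (eVec n i) (𝓕⁻ b))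

theorem advSchwartz_apply {n : ℕ} (A : Fin n → 𝓢(Ell n, ℂ)) (b : 𝓢(Ell n, ℂ)) (x : Ell n) :
    advSchwartz A b x = ∑ i, 𝓕⁻ (A i) x *
      (LineDeriv.lineDerivOp (eVec n i) (𝓕⁻ b) : 𝓢(Ell n, ℂ)) x := by
  simp [advSchwartz]

theorem adv_eq_advSchwartz {n : ℕ} (A : Fin n → 𝓢(Ell n, ℂ)) (b : Fin n → 𝓢(Ell n, ℂ))
    (l : Fin n) :
    adv (fun i => (𝓕⁻ (A i) : 𝓢(Ell n, ℂ))) (fun l' => (𝓕⁻ (b l') : 𝓢(Ell n, ℂ))) l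
      = advSchwartz A (b l) := by
  ext x
  rw [advSchwartz_apply]
  rfl

theorem integral_norm_sq_advSchwartz_le {n : ℕ} (A : Fin n → 𝓢(Ell n, ℂ)) (b : 𝓢(Ell n, ℂ)) {r : ℝ}
    (hA : ∀ i ξ, A i ξ ≠ 0 → ‖ξ‖ ≤ r) (hb : ∀ ξ, b ξ ≠ 0 → ‖ξ‖ ≤ r) :
    ∫ x, ‖advSchwartz A b x‖ ^ 2 ≤ n * volume.real (Metric.closedBall (0 : Ell n) r) *
      (2 * Real.pi * r) ^ 2 * (∑ i, ∫ ξ, ‖A i ξ‖ ^ 2) * ∫ ξ, ‖b ξ‖ ^ 2 := by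
  set M := volume.real (Metric.closedBall (0 : Ell n) r)
  have hM : 0 ≤ M := measureReal_nonneg
  let D : Fin n → 𝓢(Ell n, ℂ) := fun i => LineDeriv.lineDerivOp (eVec n i) (𝓕⁻ b)
  have hD : ∀ i, ∫ x, ‖D i x‖ ^ 2 ≤ (2 * Real.pi * r) ^ 2 * ∫ ξ, ‖b ξ‖ ^ 2 := fun i =>
    integral_norm_sq_lineDeriv_fourierInv_le b hb _ (by simp [eVec])
  have hI : ∀ i, Integrable fun x => (M * ∫ ξ, ‖A i ξ‖ ^ 2) * ‖D i x‖ ^ 2 :=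
    fun i => (D i).integrable_norm_sq.const_mul _
  have hpt : ∀ x, ‖advSchwartz A b x‖ ^ 2 ≤
      n * ∑ i, (M * ∫ ξ, ‖A i ξ‖ ^ 2) * ‖D i x‖ ^ 2 := by
    intro x
    rw [advSchwartz_apply]
    calc _ ≤ (∑ i, ‖𝓕⁻ (A i) x * D i x‖) ^ 2 := by
          gcongr
          exact norm_sum_le _ _
      _ ≤ n * ∑ i, ‖𝓕⁻ (A i) x * D i x‖ ^ 2 := by
          simpa using sq_sum_le_card_mul_sum_sq (s := Finset.univ)
            (f := fun i => ‖𝓕⁻ (A i) x * D i x‖)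
      _ ≤ _ := by
          gcongr with i
          rw [norm_mul, mul_pow]
          gcongr
          exact norm_fourierInv_sq_le (A i) (hA i) x
  calc _ ≤ ∫ x, n * ∑ i, (M * ∫ ξ, ‖A i ξ‖ ^ 2) * ‖D i x‖ ^ 2 :=
        integral_mono (SchwartzMap.integrable_norm_sq _)
          ((integrable_finsetSum _ fun i _ => hI i).const_mul _) hpt
    _ = n * ∑ i, (M * ∫ ξ, ‖A i ξ‖ ^ 2) * ∫ x, ‖D i x‖ ^ 2 := by
        rw [integral_const_mul, integral_finsetSum _ fun i _ => hI i]
        simp only [integral_const_mul]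
    _ ≤ n * ∑ i, (M * ∫ ξ, ‖A i ξ‖ ^ 2) * ((2 * Real.pi * r) ^ 2 * ∫ ξ, ‖b ξ‖ ^ 2) := by
        gcongr with i
        exact hD i
    _ = _ := by
        rw [← Finset.sum_mul, ← Finset.mul_sum]
        ring

theorem fourier_advSchwartz_support {n : ℕ} (A : Fin n → 𝓢(Ell n, ℂ)) (b : 𝓢(Ell n, ℂ)) {r : ℝ}
    (hA : ∀ i ξ, A i ξ ≠ 0 → ‖ξ‖ ≤ r) (hb : ∀ ξ, b ξ ≠ 0 → ‖ξ‖ ≤ r) (ξ : Ell n)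
    (hξ : 𝓕 (advSchwartz A b) ξ ≠ 0) : ‖ξ‖ ≤ 2 * r := by
  have e : 𝓕 (advSchwartz A b) = ∑ i, 𝓕 (pairing (ContinuousLinearMap.mul ℂ ℂ) (𝓕⁻ (A i))
      (LineDeriv.lineDerivOp (eVec n i) (𝓕⁻ b))) :=
    map_sum (FourierTransform.fourierCLM ℂ 𝓢(Ell n, ℂ)) _ _
  rw [e, sum_apply] at hξ
  obtain ⟨i, -, hi⟩ := Finset.exists_ne_zero_of_sum_ne_zero hξ
  rw [two_mul]
  refine norm_le_of_fourier_mul_ne_zero (𝓕⁻ (A i)) (LineDeriv.lineDerivOp (eVec n i) (𝓕⁻ b))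
    (fun ζ hζ => hA i ζ ?_) (fun ζ hζ => hb ζ ?_) ξ ?_
  · simpa using hζ
  · rw [fourier_lineDerivOp_eq, FourierTransform.fourier_fourierInv_eq] at hζ
    intro h
    have hg : (fun ξ : Ell n => inner ℝ ξ (eVec n i)).HasTemperateGrowth := by fun_prop
    exact hζ (by simp [smulLeftCLM_apply_apply hg, h])
  · rw [SchwartzMap.fourier_coe] at hi
    convert hi using 3
    simp

/-- Both terms of the commutator are bounded separately, for spectra in a ball of radius `r`. -/
theorem integral_norm_sq_commutator_le (n : ℕ) {s : ℝ} (hs : 0 ≤ s) :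
    ∃ K > (0 : ℝ), ∀ (r : ℝ) (_ : 0 < r) (A : Fin n → 𝓢(Ell n, ℂ)) (b bΛ : 𝓢(Ell n, ℂ)),
      (∀ i ξ, A i ξ ≠ 0 → ‖ξ‖ ≤ r) → (∀ ξ, b ξ ≠ 0 → ‖ξ‖ ≤ r) →
      (∀ ξ, bΛ ξ = ((‖ξ‖ ^ s : ℝ) : ℂ) * b ξ) →
      ∫ x, ‖Lam s (advSchwartz A b) x - advSchwartz A bΛ x‖ ^ 2 ≤
        K * r ^ (2 * s + 2 + n) * (∑ i, ∫ ξ, ‖A i ξ‖ ^ 2) * ∫ ξ, ‖b ξ‖ ^ 2 := by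
  set μ₀ := volume.real (Metric.closedBall (0 : Ell n) 1) with hμ₀
  refine ⟨2 * (2 ^ (2 * s) + 1) * (n * μ₀ * (2 * Real.pi) ^ 2) + 1, by positivity, ?_⟩
  intro r hr A b bΛ hA hb hbΛ
  have hbΛ_supp : ∀ ξ, bΛ ξ ≠ 0 → ‖ξ‖ ≤ r := by
    intro ξ h
    apply hb
    intro h0
    exact h (by rw [hbΛ, h0, mul_zero])
  obtain ⟨h1, h2⟩ := memLp_Lam_of_fourier_support hs (advSchwartz A b)
    (fourier_advSchwartz_support A b hA hb)
  have h3 := integral_norm_sq_advSchwartz_le A b hA hb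
  have h4 := integral_norm_sq_advSchwartz_le A bΛ hA hbΛ_supp
  have h5 : ∫ ξ, ‖bΛ ξ‖ ^ 2 ≤ r ^ (2 * s) * ∫ ξ, ‖b ξ‖ ^ 2 := by
    rw [← integral_const_mul]
    apply integral_mono bΛ.integrable_norm_sq (b.integrable_norm_sq.const_mul _)
    intro ξ
    simp only [hbΛ, norm_mul, mul_pow, Complex.norm_real]
    by_cases h : b ξ = 0
    · simp [h]
    · have := hb ξ h
      rw [Real.norm_of_nonneg (by positivity), ← Real.rpow_natCast,
        ← Real.rpow_mul (norm_nonneg _), mul_comm s]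
      push_cast
      gcongr
  have hvol : volume.real (Metric.closedBall (0 : Ell n) r) = r ^ n * μ₀ := by
    rw [hμ₀, Measure.real, Measure.addHaar_closedBall' _ _ hr.le, ENNReal.toReal_mul,
      ENNReal.toReal_ofReal (by positivity), finrank_euclideanSpace_fin, Measure.real]
  set a := ∑ i, ∫ ξ, ‖A i ξ‖ ^ 2
  set β := ∫ ξ, ‖b ξ‖ ^ 2
  have ha : 0 ≤ a := Finset.sum_nonneg fun i _ => integral_nonneg fun _ => by positivity
  have hβ : 0 ≤ β := integral_nonneg fun _ => by positivity
  have hI1 : Integrable fun x => ‖Lam s (advSchwartz A b) x‖ ^ 2 :=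
    (memLp_two_iff_integrable_sq_norm h1.1).1 h1
  have hI2 := (advSchwartz A bΛ).integrable_norm_sq
  have h6 : ∫ x, ‖Lam s (advSchwartz A b) x - advSchwartz A bΛ x‖ ^ 2 ≤
      2 * (∫ x, ‖Lam s (advSchwartz A b) x‖ ^ 2) + 2 * ∫ x, ‖advSchwartz A bΛ x‖ ^ 2 := by
    rw [← integral_const_mul, ← integral_const_mul,
      ← integral_add (hI1.const_mul _) (hI2.const_mul _)]
    apply integral_mono_of_nonneg (ae_of_all _ fun _ => by positivity)
      ((hI1.const_mul _).add (hI2.const_mul _)) (ae_of_all _ fun x => ?_)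
    have := norm_sub_le (Lam s (advSchwartz A b) x) (advSchwartz A bΛ x)
    simp only [Pi.add_apply]
    nlinarith [sq_nonneg (‖Lam s (advSchwartz A b) x‖ - ‖advSchwartz A bΛ x‖),
      norm_nonneg (Lam s (advSchwartz A b) x - advSchwartz A bΛ x)]
  rw [hvol] at h3 h4
  have hpow : r ^ (2 * s + 2 + n) = r ^ (2 * s) * r ^ 2 * r ^ n := by
    rw [Real.rpow_add hr, Real.rpow_add hr]
    norm_cast
  calc _ ≤ 2 * ((2 * r) ^ (2 * s) * (n * (r ^ n * μ₀) * (2 * Real.pi * r) ^ 2 * a * β)) +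
        2 * (n * (r ^ n * μ₀) * (2 * Real.pi * r) ^ 2 * a * (r ^ (2 * s) * β)) := by
        refine h6.trans ?_
        gcongr
        · exact h2.trans (by gcongr)
        · exact h4.trans (by gcongr)
    _ = (2 * (2 ^ (2 * s) + 1) * (n * μ₀ * (2 * Real.pi) ^ 2)) * r ^ (2 * s + 2 + n) * a * β := by
        rw [hpow, Real.mul_rpow (by norm_num) hr.le]
        ring
    _ ≤ _ := by
        gcongr
        linarith

/-- Dyadic localization turns a homogeneous weight into a power of the dyadic scale. -/
theorem rpow_mul_integral_norm_sq_le {V : Type*} [NormedAddCommGroup V] [MeasurableSpace V]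
    {μ : Measure V} {a f : V → ℂ} {w : V → ℝ} {t κ q : ℝ} (ht : 0 ≤ t) (hκ : 0 ≤ κ) (hq : 0 ≤ q)
    (hw : ∀ ξ, 0 ≤ w ξ) (ha : ∀ ξ, a ξ ≠ 0 → t ≤ κ * ‖ξ‖)
    (haf : ∀ ξ, ‖a ξ‖ ^ 2 ≤ w ξ * ‖f ξ‖ ^ 2)
    (hint : Integrable (fun ξ => w ξ * (‖ξ‖ ^ (2 * q) * ‖f ξ‖ ^ 2)) μ) :
    t ^ (2 * q) * ∫ ξ, ‖a ξ‖ ^ 2 ∂μ ≤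
      κ ^ (2 * q) * ∫ ξ, w ξ * (‖ξ‖ ^ (2 * q) * ‖f ξ‖ ^ 2) ∂μ := by
  rw [← integral_const_mul, ← integral_const_mul]
  apply integral_mono_of_nonneg (ae_of_all _ fun _ => by positivity) (hint.const_mul _)
    (ae_of_all _ fun ξ => ?_)
  have hwξ := hw ξ
  by_cases h : a ξ = 0
  · simp only [h, norm_zero, ne_eq, OfNat.ofNat_ne_zero, not_false_eq_true, zero_pow, mul_zero]
    positivity
  · calc t ^ (2 * q) * ‖a ξ‖ ^ 2 ≤ (κ * ‖ξ‖) ^ (2 * q) * (w ξ * ‖f ξ‖ ^ 2) := by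
          gcongr
          · exact ha ξ h
          · exact haf ξ
      _ = _ := by
          rw [Real.mul_rpow hκ (norm_nonneg _)]
          ring

theorem SchwartzMap.integrable_norm_rpow_mul_norm_sq {V : Type*} [NormedAddCommGroup V]
    [InnerProductSpace ℝ V] [FiniteDimensional ℝ V] [MeasurableSpace V] [BorelSpace V]
    (f : 𝓢(V, ℂ)) {p : ℝ} (hp : 0 ≤ p) : Integrable fun ξ => ‖ξ‖ ^ p * ‖f ξ‖ ^ 2 := by
  obtain ⟨k, hk⟩ := exists_nat_ge p
  set C := SchwartzMap.seminorm ℝ 0 0 f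
  have hI : Integrable fun ξ : V => C * (‖f ξ‖ + ‖ξ‖ ^ k * ‖f ξ‖) :=
    (f.integrable.norm.add (f.integrable_pow_mul volume k)).const_mul _
  refine hI.mono' ((continuous_norm.rpow_const fun _ => Or.inr hp).mul
    (f.continuous.norm.pow 2)).aestronglyMeasurable (ae_of_all _ fun ξ => ?_)
  have hf : ‖f ξ‖ ≤ C := norm_le_seminorm ℝ f ξ
  have hpow : ‖ξ‖ ^ p ≤ 1 + ‖ξ‖ ^ k := by
    rcases le_total ‖ξ‖ 1 with h | h
    · linarith [Real.rpow_le_one (norm_nonneg ξ) h hp, pow_nonneg (norm_nonneg ξ) k]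
    · have := Real.rpow_le_rpow_of_exponent_le h hk
      rw [Real.rpow_natCast] at this
      linarith
  rw [Real.norm_of_nonneg (by positivity)]
  calc ‖ξ‖ ^ p * ‖f ξ‖ ^ 2 ≤ (1 + ‖ξ‖ ^ k) * (C * ‖f ξ‖) := by
        rw [sq]
        gcongr
    _ = _ := by ring

theorem SchwartzMap.exists_eq_mul {V : Type*} [NormedAddCommGroup V] [NormedSpace ℝ V]
    (f : 𝓢(V, ℂ)) {m : V → ℂ} (hm : ContDiff ℝ (⊤ : ℕ∞) m) (hc : HasCompactSupport m) :
    ∃ b : 𝓢(V, ℂ), ∀ ξ, b ξ = m ξ * f ξ :=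
  ⟨HasCompactSupport.toSchwartzMap (f := fun ξ => m ξ * f ξ) hc.mul_right (hm.mul (f.smooth _)),
    fun _ => rfl⟩

namespace LPFunction

variable {n : ℕ} {φ : Ell n → ℝ}

theorem norm_bounds (hφ : LPFunction φ) {j : ℤ} {ξ : Ell n}
    (h : φ ((2 : ℝ) ^ (-j) • ξ) ≠ 0) :
    3 / 4 * (2 : ℝ) ^ j ≤ ‖ξ‖ ∧ ‖ξ‖ ≤ 8 / 3 * (2 : ℝ) ^ j := by
  have h2 : (0 : ℝ) < 2 ^ j := by positivity
  obtain ⟨h3, h4⟩ := hφ.2.2.1 _ h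
  rw [norm_smul, Real.norm_of_nonneg (by positivity), zpow_neg, inv_mul_eq_div] at h3 h4
  exact ⟨(le_div_iff₀ h2).1 h3, (div_le_iff₀ h2).1 h4⟩

theorem contDiff_dilate (hφ : LPFunction φ) (j : ℤ) :
    ContDiff ℝ (⊤ : ℕ∞) fun ξ : Ell n => ((φ ((2 : ℝ) ^ (-j) • ξ) : ℝ) : ℂ) :=
  Complex.ofRealCLM.contDiff.comp (hφ.1.comp (contDiff_const_smul _))

theorem hasCompactSupport_dilate (hφ : LPFunction φ) (j : ℤ) :
    HasCompactSupport fun ξ : Ell n => ((φ ((2 : ℝ) ^ (-j) • ξ) : ℝ) : ℂ) := by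
  apply HasCompactSupport.intro (isCompact_closedBall (0 : Ell n) (8 / 3 * (2 : ℝ) ^ j))
  intro ξ hξ
  by_contra h
  exact hξ (by simpa using (hφ.norm_bounds (by simpa using h)).2)

theorem contDiff_norm_rpow_mul_dilate (hφ : LPFunction φ) (s : ℝ) (j : ℤ) :
    ContDiff ℝ (⊤ : ℕ∞) fun ξ : Ell n =>
      ((‖ξ‖ ^ s : ℝ) : ℂ) * ((φ ((2 : ℝ) ^ (-j) • ξ) : ℝ) : ℂ) := by
  rw [contDiff_iff_contDiffAt]
  intro ξ
  by_cases h : ξ = 0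
  · have hev : (fun ξ : Ell n => ((‖ξ‖ ^ s : ℝ) : ℂ) * ((φ ((2 : ℝ) ^ (-j) • ξ) : ℝ) : ℂ))
        =ᶠ[nhds ξ] fun _ => 0 := by
      have hpos : (0 : ℝ) < 3 / 4 * (2 : ℝ) ^ j := by positivity
      rw [h]
      filter_upwards [Metric.ball_mem_nhds (0 : Ell n) hpos] with ζ hζ
      have : φ ((2 : ℝ) ^ (-j) • ζ) = 0 := by
        by_contra h0
        exact absurd (hφ.norm_bounds h0).1 (by simpa using hζ)
      simp only [this, Complex.ofReal_zero, mul_zero]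
    exact contDiffAt_const.congr_of_eventuallyEq hev
  · refine ContDiffAt.mul ?_ (hφ.contDiff_dilate j).contDiffAt
    exact Complex.ofRealCLM.contDiff.contDiffAt.comp ξ
      ((contDiffAt_norm ℝ h).rpow_const_of_ne (norm_ne_zero_iff.2 h))

theorem sum_dilate_le_one (hφ : LPFunction φ) (F : Finset ℤ) (ξ : Ell n) :
    ∑ j ∈ F, φ ((2 : ℝ) ^ (-j) • ξ) ≤ 1 := by
  by_cases h : ξ = 0
  · have h0 : φ 0 = 0 := by
      by_contra h0
      have := (hφ.2.2.1 0 h0).1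
      norm_num at this
    simp [h, h0]
  · have h1 := hφ.2.2.2.2.2.1 ξ h
    have hs : Summable fun j : ℤ => φ ((2 : ℝ) ^ (-j) • ξ) := by
      by_contra hs
      rw [tsum_eq_zero_of_not_summable hs] at h1
      exact zero_ne_one h1
    rw [← h1]
    exact hs.sum_le_tsum F fun j _ => (hφ.2.2.2.1 _).1

end LPFunction

theorem Hnorm_sq {n : ℕ} (s : ℝ) (u : Fin n → Ell n → ℝ) :
    Hnorm s u ^ 2 = ∑ l, HsqC s (cf (u l)) :=
  Real.sq_sqrt (Finset.sum_nonneg fun _ _ => integral_nonneg fun _ => by positivity)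

/-- **Diagonal commutator piece.** Under the conditions `s ≥ 1`,
`1 ≤ s₁ < n/2 + 1`, `s₂ > 0`, `s₁ + s₂ = s + n/2 + 1`, one has
`Σ_j ‖Λ^s[((Σ_{i=j−9}^{j+9}Δ_i u)·∇)Δ_j B] − ((Σ_{i=j−9}^{j+9}Δ_i u)·∇)(Λ^s Δ_j B)‖²_{L²}
≤ c ‖u‖²_{Ḣ^{s₁}} ‖B‖²_{Ḣ^{s₂}}`. -/
theorem commutator_piece_diagonal (n : ℕ) (hn : 1 ≤ n)
    (φ : Ell n → ℝ) (hφ : LPFunction φ) (s s₁ s₂ : ℝ)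
    (hs : 1 ≤ s) (hs₂ : 0 < s₂) (hs₁ : 1 ≤ s₁) (hs₁' : s₁ < (n : ℝ) / 2 + 1)
    (hsum : s₁ + s₂ = s + (n : ℝ) / 2 + 1) :
    ∃ c > (0 : ℝ), ∀ u B : Fin n → 𝓢(Ell n, ℝ),
      (∑' j : ℤ, ∑ l, ∫ x,
          ‖Lam s (adv (fun i x' => ∑ m ∈ Finset.Icc (j - 9) (j + 9),
                DeltaJ φ m (cf (u i)) x')
              (fun l' => DeltaJ φ j (cf (B l'))) l) x
            - adv (fun i x' => ∑ m ∈ Finset.Icc (j - 9) (j + 9),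
                DeltaJ φ m (cf (u i)) x')
              (fun l' => Lam s (DeltaJ φ j (cf (B l')))) l x‖ ^ 2)
        ≤ c * Hnorm s₁ (fun l x => u l x) ^ 2 * Hnorm s₂ (fun l x => B l x) ^ 2 := by
  obtain ⟨K, hK, hcomm⟩ := integral_norm_sq_commutator_le n (s := s) (by linarith)
  set R : ℝ := 8 / 3 * 2 ^ 9 with hR
  set κ : ℝ := 4 / 3 * 2 ^ 9 with hκ
  refine ⟨K * R ^ (2 * s + 2 + n) * κ ^ (2 * s₁) * κ ^ (2 * s₂), by positivity, fun u B => ?_⟩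
  obtain ⟨g, hF⟩ : ∃ g : 𝓢(Ell n, ℝ) → 𝓢(Ell n, ℂ), ∀ f : 𝓢(Ell n, ℝ), 𝓕 (cf f) = g f := by
    refine ⟨fun f => 𝓕 (f.postcompCLM Complex.ofRealCLM : 𝓢(Ell n, ℂ)), fun f => ?_⟩
    rw [SchwartzMap.fourier_coe]
    congr 1
  choose a ha using fun (j : ℤ) (f : 𝓢(Ell n, ℝ)) =>
    (g f).exists_eq_mul (hφ.contDiff_dilate j) (hφ.hasCompactSupport_dilate j)
  choose aΛ haΛ using fun (j : ℤ) (f : 𝓢(Ell n, ℝ)) =>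
    (g f).exists_eq_mul (hφ.contDiff_norm_rpow_mul_dilate s j)
      (hφ.hasCompactSupport_dilate j).mul_left
  have hΔ : ∀ j f, DeltaJ φ j (cf (f : 𝓢(Ell n, ℝ))) = (𝓕⁻ (a j f) : 𝓢(Ell n, ℂ)) := by
    intro j f
    rw [SchwartzMap.fourierInv_coe, funext (ha j f), DeltaJ, hF]
  have hLΔ : ∀ j f, Lam s (DeltaJ φ j (cf (f : 𝓢(Ell n, ℝ)))) = (𝓕⁻ (aΛ j f) : 𝓢(Ell n, ℂ)) := by
    intro j f
    rw [hΔ, SchwartzMap.fourierInv_coe (aΛ j f), Lam, ← SchwartzMap.fourier_coe,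
      FourierTransform.fourier_fourierInv_eq]
    congr 1
    ext ξ
    rw [ha, haΛ, mul_assoc]
  let A : ℤ → Fin n → 𝓢(Ell n, ℂ) := fun j i => ∑ m ∈ Finset.Icc (j - 9) (j + 9), a m (u i)
  have hA : ∀ j i ξ, A j i ξ = ∑ m ∈ Finset.Icc (j - 9) (j + 9),
      ((φ ((2 : ℝ) ^ (-m) • ξ) : ℝ) : ℂ) * g (u i) ξ := by
    intro j i ξ
    simp only [A, sum_apply, ha]
  have hvel : ∀ j, (fun i x' => ∑ m ∈ Finset.Icc (j - 9) (j + 9), DeltaJ φ m (cf (u i)) x')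
      = fun i => ((𝓕⁻ (A j i) : 𝓢(Ell n, ℂ)) : Ell n → ℂ) := by
    intro j
    ext i x
    have : 𝓕⁻ (A j i) = ∑ m ∈ Finset.Icc (j - 9) (j + 9), 𝓕⁻ (a m (u i)) :=
      map_sum (FourierTransform.fourierInvCLM ℂ 𝓢(Ell n, ℂ)) _ _
    simp only [this, sum_apply, hΔ]
  have h2 : ∀ j : ℤ, (0 : ℝ) < 2 ^ j := fun j => by positivity
  have hAsupp : ∀ j i ξ, A j i ξ ≠ 0 → (2 : ℝ) ^ j ≤ κ * ‖ξ‖ ∧ ‖ξ‖ ≤ R * 2 ^ j := by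
    intro j i ξ h
    rw [hA] at h
    obtain ⟨m, hm, hne⟩ := Finset.exists_ne_zero_of_sum_ne_zero h
    obtain ⟨hl, hu⟩ := hφ.norm_bounds (j := m) (ξ := ξ) fun h0 =>
      hne (by rw [h0, Complex.ofReal_zero, zero_mul])
    rw [Finset.mem_Icc] at hm
    have e1 : (2 : ℝ) ^ j ≤ 2 ^ 9 * 2 ^ m := by
      rw [← zpow_natCast, ← zpow_add₀ two_ne_zero]
      exact zpow_le_zpow_right₀ one_le_two (by push_cast; omega)
    have e2 : (2 : ℝ) ^ m ≤ 2 ^ 9 * 2 ^ j := by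
      rw [← zpow_natCast, ← zpow_add₀ two_ne_zero]
      exact zpow_le_zpow_right₀ one_le_two (by push_cast; omega)
    constructor
    · rw [hκ]
      linarith
    · rw [hR]
      linarith
  have hasupp : ∀ j f ξ, a j f ξ ≠ 0 → (2 : ℝ) ^ j ≤ κ * ‖ξ‖ ∧ ‖ξ‖ ≤ R * 2 ^ j := by
    intro j f ξ h
    obtain ⟨hl, hu⟩ := hφ.norm_bounds (j := j) (ξ := ξ) fun h0 =>
      h (by rw [ha, h0, Complex.ofReal_zero, zero_mul])
    have := h2 j
    constructor
    · rw [hκ]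
      linarith
    · rw [hR]
      linarith
  have hHsq : ∀ q (f : 𝓢(Ell n, ℝ)), HsqC q (cf f) = ∫ ξ, ‖ξ‖ ^ (2 * q) * ‖g f ξ‖ ^ 2 := by
    intro q f
    rw [HsqC, hF]
  have hu : ∀ j : ℤ, ((2 : ℝ) ^ j) ^ (2 * s₁) * ∑ i, ∫ ξ, ‖A j i ξ‖ ^ 2 ≤
      κ ^ (2 * s₁) * Hnorm s₁ (fun l x => u l x) ^ 2 := by
    intro j
    rw [Hnorm_sq, Finset.mul_sum, Finset.mul_sum]
    refine Finset.sum_le_sum fun i _ => ?_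
    have := rpow_mul_integral_norm_sq_le (μ := volume) (a := A j i) (f := g (u i))
      (w := fun _ => 1) (h2 j).le (by positivity : 0 ≤ κ) (by linarith : 0 ≤ s₁) (by simp)
      (fun ξ h => (hAsupp j i ξ h).1) (fun ξ => ?_)
      (by simpa only [one_mul] using
        (g (u i)).integrable_norm_rpow_mul_norm_sq (p := 2 * s₁) (by linarith))
    · simpa only [one_mul, hHsq] using this
    · rw [hA, ← Finset.sum_mul, norm_mul, mul_pow, ← Complex.ofReal_sum, Complex.norm_real,
        Real.norm_of_nonneg (Finset.sum_nonneg fun m _ => (hφ.2.2.2.1 _).1)]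
      gcongr
      exact pow_le_one₀ (Finset.sum_nonneg fun m _ => (hφ.2.2.2.1 _).1)
        (hφ.sum_dilate_le_one _ ξ)
  let I : ℤ → Fin n → ℝ := fun j l => ∫ ξ, φ ((2 : ℝ) ^ (-j) • ξ) *
    (‖ξ‖ ^ (2 * s₂) * ‖g (B l) ξ‖ ^ 2)
  have hint : ∀ l, Integrable fun ξ => ‖ξ‖ ^ (2 * s₂) * ‖g (B l) ξ‖ ^ 2 := fun l =>
    (g (B l)).integrable_norm_rpow_mul_norm_sq (by linarith)
  have hIint : ∀ (j : ℤ) l, Integrable fun ξ => φ ((2 : ℝ) ^ (-j) • ξ) *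
      (‖ξ‖ ^ (2 * s₂) * ‖g (B l) ξ‖ ^ 2) := by
    intro j l
    refine (hint l).bdd_mul (c := 1)
      (hφ.1.continuous.comp (continuous_const_smul _)).aestronglyMeasurable
      (ae_of_all _ fun ξ => ?_)
    obtain ⟨h0, h1⟩ := hφ.2.2.2.1 ((2 : ℝ) ^ (-j) • ξ)
    rwa [Real.norm_of_nonneg h0]
  have hB : ∀ (j : ℤ) l, ((2 : ℝ) ^ j) ^ (2 * s₂) * ∫ ξ, ‖a j (B l) ξ‖ ^ 2 ≤
      κ ^ (2 * s₂) * I j l := by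
    intro j l
    refine rpow_mul_integral_norm_sq_le (h2 j).le (by positivity) hs₂.le
      (fun ξ => (hφ.2.2.2.1 _).1) (fun ξ h => (hasupp j _ ξ h).1) (fun ξ => ?_) (hIint j l)
    obtain ⟨h0, h1⟩ := hφ.2.2.2.1 ((2 : ℝ) ^ (-j) • ξ)
    rw [ha, norm_mul, mul_pow, Complex.norm_real, Real.norm_of_nonneg h0]
    gcongr
    exact pow_le_of_le_one h0 h1 two_ne_zero
  have hIsum : ∀ F : Finset ℤ, ∑ j ∈ F, ∑ l, I j l ≤ Hnorm s₂ (fun l x => B l x) ^ 2 := by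
    intro F
    rw [Hnorm_sq, Finset.sum_comm]
    refine Finset.sum_le_sum fun l _ => ?_
    rw [hHsq, ← integral_finsetSum _ fun j _ => hIint j l]
    refine integral_mono (integrable_finsetSum _ fun j _ => hIint j l) (hint l) fun ξ => ?_
    simp only [← Finset.sum_mul]
    exact mul_le_of_le_one_left (by positivity) (hφ.sum_dilate_le_one F ξ)
  have hblock : ∀ j : ℤ, (∑ l, ∫ x,
      ‖Lam s (adv (fun i x' => ∑ m ∈ Finset.Icc (j - 9) (j + 9), DeltaJ φ m (cf (u i)) x')
          (fun l' => DeltaJ φ j (cf (B l'))) l) x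
        - adv (fun i x' => ∑ m ∈ Finset.Icc (j - 9) (j + 9), DeltaJ φ m (cf (u i)) x')
          (fun l' => Lam s (DeltaJ φ j (cf (B l')))) l x‖ ^ 2) ≤
      K * R ^ (2 * s + 2 + n) * κ ^ (2 * s₁) * κ ^ (2 * s₂) *
        Hnorm s₁ (fun l x => u l x) ^ 2 * ∑ l, I j l := by
    intro j
    rw [hvel, Finset.mul_sum]
    refine Finset.sum_le_sum fun l _ => ?_
    simp only [hLΔ]
    simp only [hΔ, adv_eq_advSchwartz]
    refine (hcomm (R * 2 ^ j) (by positivity) (A j) (a j (B l)) (aΛ j (B l))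
      (fun i ξ h => (hAsupp j i ξ h).2) (fun ξ h => (hasupp j _ ξ h).2)
      (fun ξ => by rw [ha, haΛ, mul_assoc])).trans ?_
    have hpow : (R * (2 : ℝ) ^ j) ^ (2 * s + 2 + n) =
        R ^ (2 * s + 2 + n) * (((2 : ℝ) ^ j) ^ (2 * s₁) * ((2 : ℝ) ^ j) ^ (2 * s₂)) := by
      rw [Real.mul_rpow (by positivity) (h2 j).le, ← Real.rpow_add (h2 j)]
      congr 2
      linarith
    calc _ = K * R ^ (2 * s + 2 + n) *
          (((2 : ℝ) ^ j) ^ (2 * s₁) * ∑ i, ∫ ξ, ‖A j i ξ‖ ^ 2) *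
          (((2 : ℝ) ^ j) ^ (2 * s₂) * ∫ ξ, ‖a j (B l) ξ‖ ^ 2) := by
          rw [hpow]
          ring
      _ ≤ K * R ^ (2 * s + 2 + n) * (κ ^ (2 * s₁) * Hnorm s₁ (fun l x => u l x) ^ 2) *
          (κ ^ (2 * s₂) * I j l) := by
          refine mul_le_mul (mul_le_mul_of_nonneg_left (hu j) (by positivity)) (hB j l) ?_
            (by positivity)
          exact mul_nonneg (by positivity) (integral_nonneg fun _ => by positivity)
      _ = _ := by ring
  refine tsum_le_of_sum_le' (by positivity) fun F => ?_
  refine (Finset.sum_le_sum fun j _ => hblock j).trans ?_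
  rw [← Finset.mul_sum]
  gcongr
  exact hIsum F

end
end

section
/- Let n ≥ 1 and let u : ℝⁿ → ℝⁿ be a divergence-free Schwartz vector field. There exist a constant c > 0 (depending only on n and φ) and a nonnegative sequence (d_k)_{k∈ℤ} with Σ_{k∈ℤ} d_k = 1 such that for every k ∈ ℤ and every component index l, ‖Σ_{j∈ℤ} [Δ_k, Σᵢ Ṡ_{j−1}uᵢ ∂ᵢ](Δ_j u_l)‖_{L²} ≤ c·d_k·2^{−k(n/2+1)}·‖u‖²_{Ḃ^{n/2+1}_{2,1}}, where [Δ_k, Σᵢ Ṡ_{j−1}uᵢ ∂ᵢ] f = Δ_k(Σᵢ Ṡ_{j−1}uᵢ ∂ᵢf) − Σᵢ Ṡ_{j−1}uᵢ ∂ᵢ(Δ_k f). -/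
open MeasureTheory Filter SchwartzMap
open scoped FourierTransform

noncomputable section

/-- A vector field is divergence free: `Σᵢ ∂ᵢuᵢ = 0`. -/
def DivFree {n : ℕ} (u : Fin n → 𝓢(Ell n, ℝ)) : Prop :=
  ∀ x, ∑ i, fderiv ℝ (fun y => u i y) x (eVec n i) = 0

/-! ### General facts on `L²` norms and convolutions -/

lemma sq_lintegral_mul_le {α : Type*} [MeasurableSpace α] (μ : Measure α) {w v : α → ENNReal}
    (hw : AEMeasurable w μ) (hv : AEMeasurable v μ) :
    (∫⁻ x, w x * v x ∂μ) ^ 2 ≤ (∫⁻ x, w x ∂μ) * ∫⁻ x, w x * v x ^ 2 ∂μ := by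
  have h := ENNReal.lintegral_mul_norm_pow_le (μ := μ) hw (hw.mul (hv.pow_const 2))
    (p := 1 / 2) (q := 1 / 2) (by norm_num) (by norm_num) (by norm_num)
  have hpt : ∀ x, w x ^ (1 / 2 : ℝ) * (w x * v x ^ 2) ^ (1 / 2 : ℝ) = w x * v x := by
    intro x
    rw [ENNReal.mul_rpow_of_nonneg _ _ (by norm_num), ← mul_assoc,
      ← ENNReal.rpow_add_of_nonneg _ _ (by norm_num) (by norm_num), ← ENNReal.rpow_natCast,
      ← ENNReal.rpow_mul]
    norm_num
  simp only [Pi.mul_apply, hpt] at h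
  calc (∫⁻ x, w x * v x ∂μ) ^ 2
      ≤ ((∫⁻ x, w x ∂μ) ^ (1 / 2 : ℝ) * (∫⁻ x, w x * v x ^ 2 ∂μ) ^ (1 / 2 : ℝ)) ^ 2 := by
        gcongr
    _ = _ := by
        rw [mul_pow, ← ENNReal.rpow_natCast, ← ENNReal.rpow_natCast, ← ENNReal.rpow_mul,
          ← ENNReal.rpow_mul]
        norm_num

/-- Young's inequality `L¹ * L² ⊆ L²`. -/
lemma lintegral_sq_conv_le {n : ℕ} {w v : Ell n → ENNReal} (hw : Measurable w)
    (hv : Measurable v) :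
    ∫⁻ ξ, (∫⁻ η, w η * v (ξ - η)) ^ 2 ≤ (∫⁻ η, w η) ^ 2 * ∫⁻ ζ, v ζ ^ 2 := by
  calc ∫⁻ ξ, (∫⁻ η, w η * v (ξ - η)) ^ 2
      ≤ ∫⁻ ξ, (∫⁻ η, w η) * ∫⁻ η, w η * v (ξ - η) ^ 2 := by
        refine lintegral_mono fun ξ => ?_
        exact sq_lintegral_mul_le volume hw.aemeasurable (by fun_prop)
    _ = (∫⁻ η, w η) * ∫⁻ η, ∫⁻ ξ, w η * v (ξ - η) ^ 2 := by
        rw [lintegral_const_mul _ (by fun_prop), lintegral_lintegral_swap]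
        fun_prop
    _ = (∫⁻ η, w η) * ∫⁻ η, w η * ∫⁻ ζ, v ζ ^ 2 := by
        congr 1
        refine lintegral_congr fun η => ?_
        rw [lintegral_const_mul _ (by fun_prop),
          lintegral_sub_right_eq_self (fun ζ => v ζ ^ 2) η]
    _ = _ := by
        rw [lintegral_mul_const _ hw, sq, mul_assoc]

/-- The `L²` norm of a Schwartz function. -/
abbrev schwartzL2 {n : ℕ} (f : 𝓢(Ell n, ℂ)) : ℝ := ‖f.toLp 2 volume‖

lemma sqrt_integral_norm_sq_eq_schwartzL2 {n : ℕ} (f : 𝓢(Ell n, ℂ)) :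
    Real.sqrt (∫ x, ‖f x‖ ^ 2) = schwartzL2 f := by
  rw [schwartzL2, norm_toLp' (by norm_num) (by norm_num), Real.sqrt_eq_rpow]
  norm_num

lemma lintegral_enorm_sq_eq_schwartzL2 {n : ℕ} (f : 𝓢(Ell n, ℂ)) :
    ∫⁻ x, ‖f x‖ₑ ^ 2 = ENNReal.ofReal (schwartzL2 f) ^ 2 := by
  rw [← sqrt_integral_norm_sq_eq_schwartzL2, ← ENNReal.ofReal_pow (Real.sqrt_nonneg _),
    Real.sq_sqrt (by positivity), ofReal_integral_eq_lintegral_ofReal]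
  · refine lintegral_congr fun x => ?_
    rw [ENNReal.ofReal_pow (norm_nonneg _), ofReal_norm]
  · exact (f.memLp 2).integrable_norm_pow (by norm_num)
  · exact Eventually.of_forall fun x => by positivity

lemma schwartzL2_fourierInv {n : ℕ} (f : 𝓢(Ell n, ℂ)) : schwartzL2 (𝓕⁻ f) = schwartzL2 f := by
  have h := norm_fourier_toL2_eq (𝓕⁻ f)
  rw [FourierTransform.fourier_fourierInv_eq] at h
  exact h.symm

lemma schwartzL2_sum_le {n : ℕ} {ι : Type*} (s : Finset ι) (f : ι → 𝓢(Ell n, ℂ)) :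
    schwartzL2 (∑ i ∈ s, f i) ≤ ∑ i ∈ s, schwartzL2 (f i) := by
  have h : (∑ i ∈ s, f i).toLp 2 volume = ∑ i ∈ s, (f i).toLp 2 volume := by
    exact map_sum (toLpCLM ℂ ℂ 2 (volume : Measure (Ell n))) f s
  rw [schwartzL2, h]
  exact norm_sum_le _ _

lemma schwartzL2_le_of_norm_le {n : ℕ} {f g : 𝓢(Ell n, ℂ)} {C : ℝ}
    (h : ∀ x, ‖f x‖ ≤ C * ‖g x‖) : schwartzL2 f ≤ C * schwartzL2 g := by
  refine Lp.norm_le_mul_norm_of_ae_le_mul ?_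
  filter_upwards [f.coeFn_toLp 2 volume, g.coeFn_toLp 2 volume] with x hf hg
  rw [hf, hg]
  exact h x

/-- Young's inequality in the form used for the commutator. -/
lemma schwartzL2_le_of_norm_le_conv {n : ℕ} {G v : 𝓢(Ell n, ℂ)} {w : Ell n → ENNReal}
    (hw : Measurable w) {C M : ℝ} (hC : 0 ≤ C) (hM : 0 ≤ M)
    (hwM : ∫⁻ η, w η ≤ ENNReal.ofReal M)
    (h : ∀ ξ, ‖G ξ‖ₑ ≤ ENNReal.ofReal C * ∫⁻ η, w η * ‖v (ξ - η)‖ₑ) :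
    schwartzL2 G ≤ C * M * schwartzL2 v := by
  have hv : Measurable fun ζ => ‖v ζ‖ₑ := v.continuous.enorm.measurable
  have key : ENNReal.ofReal (schwartzL2 G) ^ 2
      ≤ ENNReal.ofReal (C * M * schwartzL2 v) ^ 2 := by
    rw [← lintegral_enorm_sq_eq_schwartzL2]
    calc ∫⁻ ξ, ‖G ξ‖ₑ ^ 2
        ≤ ∫⁻ ξ, ENNReal.ofReal C ^ 2 * (∫⁻ η, w η * ‖v (ξ - η)‖ₑ) ^ 2 := by
          refine lintegral_mono fun ξ => ?_
          simp only
          rw [← mul_pow]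
          gcongr
          exact h ξ
      _ = ENNReal.ofReal C ^ 2 * ∫⁻ ξ, (∫⁻ η, w η * ‖v (ξ - η)‖ₑ) ^ 2 := by
          rw [lintegral_const_mul]
          refine Measurable.pow_const (Measurable.lintegral_prod_right'
            (f := fun p : Ell n × Ell n => w p.2 * ‖v (p.1 - p.2)‖ₑ) ?_) 2
          exact (hw.comp measurable_snd).mul (hv.comp (measurable_fst.sub measurable_snd))
      _ ≤ ENNReal.ofReal C ^ 2 * ((∫⁻ η, w η) ^ 2 * ∫⁻ ζ, ‖v ζ‖ₑ ^ 2) := by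
          gcongr
          exact lintegral_sq_conv_le hw hv
      _ ≤ ENNReal.ofReal C ^ 2 * (ENNReal.ofReal M ^ 2 * ENNReal.ofReal (schwartzL2 v) ^ 2) := by
          rw [lintegral_enorm_sq_eq_schwartzL2]
          gcongr
      _ = _ := by
          rw [ENNReal.ofReal_mul (by positivity), ENNReal.ofReal_mul hC]
          ring
  rw [← ENNReal.ofReal_pow (norm_nonneg _), ← ENNReal.ofReal_pow (by positivity),
    ENNReal.ofReal_le_ofReal_iff (by positivity)] at key
  exact le_of_sq_le_sq key (by positivity)

/-- The product of two inverse Fourier transforms is the inverse Fourier transform of the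
convolution, which is a Schwartz function as soon as both factors have compact support. -/
lemma exists_schwartz_fourierInv_mul {n : ℕ} {a : Ell n → ℂ} (ha : Integrable a)
    (hac : HasCompactSupport a) (b : 𝓢(Ell n, ℂ)) (hbc : HasCompactSupport b) :
    ∃ A : 𝓢(Ell n, ℂ), (∀ ξ, A ξ = ∫ η, a η * b (ξ - η)) ∧
      ∀ x, 𝓕⁻ A x = 𝓕⁻ a x * 𝓕⁻ b x := by
  refine ⟨(hac.convolution (ContinuousLinearMap.mul ℝ ℂ) (μ := volume) hbc).toSchwartzMap
    (hbc.contDiff_convolution_right _ ha.locallyIntegrable (b.smooth ⊤)), fun ξ => rfl,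
    fun x => ?_⟩
  have h := Real.fourier_mul_convolution_eq ha b.integrable (-x)
  rw [fourierInv_coe, fourierInv_coe, Real.fourierInv_eq_fourier_neg,
    Real.fourierInv_eq_fourier_neg, Real.fourierInv_eq_fourier_neg]
  exact h

/-! ### Dyadic symbols -/

/-- The symbol `φ(2^{-k}ξ)` of `Δ_k`, as a complex function. -/
def symb {n : ℕ} (φ : Ell n → ℝ) (k : ℤ) (ξ : Ell n) : ℂ := ((φ ((2 : ℝ) ^ (-k) • ξ) : ℝ) : ℂ)

namespace LPFunction

variable {n : ℕ} {φ : Ell n → ℝ}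

lemma contDiff_symb (hφ : LPFunction φ) (k : ℤ) : ContDiff ℝ (⊤ : ℕ∞) (symb φ k) := by
  have h := hφ.1
  unfold symb
  exact Complex.ofRealCLM.contDiff.comp (h.comp (contDiff_const_smul _))

lemma norm_symb (hφ : LPFunction φ) (k : ℤ) (ξ : Ell n) :
    ‖symb φ k ξ‖ = φ ((2 : ℝ) ^ (-k) • ξ) := by
  rw [symb, Complex.norm_real, Real.norm_of_nonneg (hφ.2.2.2.1 _).1]

lemma norm_symb_le_one (hφ : LPFunction φ) (k : ℤ) (ξ : Ell n) : ‖symb φ k ξ‖ ≤ 1 := by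
  rw [hφ.norm_symb]
  exact (hφ.2.2.2.1 _).2

lemma bounds_of_symb_ne_zero (hφ : LPFunction φ) {k : ℤ} {ξ : Ell n} (h : symb φ k ξ ≠ 0) :
    3 / 4 * (2 : ℝ) ^ k ≤ ‖ξ‖ ∧ ‖ξ‖ ≤ 8 / 3 * (2 : ℝ) ^ k := by
  have hk : (0 : ℝ) < 2 ^ k := by positivity
  have h' := hφ.2.2.1 ((2 : ℝ) ^ (-k) • ξ) (by simpa [symb] using h)
  rw [norm_smul, Real.norm_of_nonneg (by positivity), zpow_neg, ← div_eq_inv_mul,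
    le_div_iff₀ hk, div_le_iff₀ hk] at h'
  exact h'

lemma hasCompactSupport_symb (hφ : LPFunction φ) (k : ℤ) : HasCompactSupport (symb φ k) := by
  refine HasCompactSupport.intro (isCompact_closedBall (0 : Ell n) (8 / 3 * (2 : ℝ) ^ k)) ?_
  intro ξ hξ
  by_contra h
  exact hξ (by simpa using (hφ.bounds_of_symb_ne_zero h).2)

lemma hasTemperateGrowth_symb (hφ : LPFunction φ) (k : ℤ) :
    (symb φ k).HasTemperateGrowth :=
  (hφ.hasCompactSupport_symb k).hasTemperateGrowth (hφ.contDiff_symb k)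

lemma summable_norm_symb (hφ : LPFunction φ) (ξ : Ell n) :
    Summable fun j : ℤ => ‖symb φ j ξ‖ := by
  simp only [hφ.norm_symb]
  by_cases h0 : ξ = 0
  · subst h0
    have : φ 0 = 0 := by
      by_contra h
      have := (hφ.2.2.1 0 h).1
      norm_num at this
    simp [this, summable_zero]
  · by_contra h
    have := hφ.2.2.2.2.2.1 ξ h0
    rw [tsum_eq_zero_of_not_summable h] at this
    norm_num at this

lemma tsum_norm_symb (hφ : LPFunction φ) {ξ : Ell n} (hξ : ξ ≠ 0) :
    ∑' j : ℤ, ‖symb φ j ξ‖ = 1 := by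
  simp only [hφ.norm_symb]
  exact hφ.2.2.2.2.2.1 ξ hξ

lemma tsum_norm_symb_le (hφ : LPFunction φ) (ξ : Ell n) :
    ∑' j : ℤ, ‖symb φ j ξ‖ ≤ 1 := by
  by_cases h0 : ξ = 0
  · have h : ∀ j : ℤ, ‖symb φ j ξ‖ = 0 := by
      intro j
      by_contra h
      have := (hφ.bounds_of_symb_ne_zero (norm_ne_zero_iff.1 h)).1
      have : (0 : ℝ) < 2 ^ j := by positivity
      simp only [h0, norm_zero] at *
      linarith
    simp [h]
  · exact (hφ.tsum_norm_symb h0).le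

lemma symb_mul_symb_eq_zero (hφ : LPFunction φ) {j k : ℤ} (h : 2 ≤ |j - k|) (ξ : Ell n) :
    symb φ j ξ * symb φ k ξ = 0 := by
  have := hφ.2.2.2.2.2.2 j k h ξ
  rw [symb, symb, ← Complex.ofReal_mul, this, Complex.ofReal_zero]

lemma exists_lipschitz_symb (hφ : LPFunction φ) :
    ∃ L : ℝ, 0 ≤ L ∧ ∀ (k : ℤ) (ξ η : Ell n),
      ‖symb φ k ξ - symb φ k (ξ - η)‖ ≤ L * (2 : ℝ) ^ (-k) * ‖η‖ := by
  obtain ⟨L, hL⟩ := ContDiff.lipschitzWith_of_hasCompactSupport hφ.2.1 hφ.1 (by simp)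
  refine ⟨L, L.2, fun k ξ η => ?_⟩
  rw [symb, symb, ← Complex.ofReal_sub, Complex.norm_real]
  refine (hL.norm_sub_le _ _).trans ?_
  rw [← smul_sub, sub_sub_cancel, norm_smul, Real.norm_of_nonneg (by positivity), mul_assoc]

/-! ### Dyadic blocks of Schwartz functions -/

lemma deltaJ_eq (hφ : LPFunction φ) (k : ℤ) (f : 𝓢(Ell n, ℂ)) :
    DeltaJ φ k f = ⇑(𝓕⁻ (smulLeftCLM ℂ (symb φ k) (𝓕 f)) : 𝓢(Ell n, ℂ)) := by
  rw [fourierInv_coe]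
  unfold DeltaJ
  congr 1
  ext ξ
  rw [smulLeftCLM_apply_apply (hφ.hasTemperateGrowth_symb k), ← fourier_coe]
  rfl

/-- The Fourier transform of `∂ᵢ Δ_j f`. -/
def derivSymb (φ : Ell n → ℝ) (i : Fin n) (j : ℤ) (f : 𝓢(Ell n, ℂ)) : 𝓢(Ell n, ℂ) :=
  (2 * ↑Real.pi * Complex.I) •
    smulLeftCLM ℂ (fun ξ : Ell n => inner ℝ ξ (eVec n i)) (smulLeftCLM ℂ (symb φ j) (𝓕 f))

lemma derivSymb_apply (hφ : LPFunction φ) (i : Fin n) (j : ℤ) (f : 𝓢(Ell n, ℂ)) (ξ : Ell n) :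
    derivSymb φ i j f ξ = (2 * ↑Real.pi * Complex.I) *
      ((inner ℝ ξ (eVec n i) : ℝ) * (symb φ j ξ * 𝓕 f ξ)) := by
  simp only [derivSymb, smul_apply, smul_eq_mul]
  rw [smulLeftCLM_apply_apply (by fun_prop),
    smulLeftCLM_apply_apply (hφ.hasTemperateGrowth_symb j), Complex.real_smul, smul_eq_mul]

lemma hasCompactSupport_derivSymb (hφ : LPFunction φ) (i : Fin n) (j : ℤ) (f : 𝓢(Ell n, ℂ)) :
    HasCompactSupport (derivSymb φ i j f) := by
  refine (hφ.hasCompactSupport_symb j).mono fun ξ hξ => ?_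
  rw [Function.mem_support] at hξ ⊢
  contrapose! hξ
  rw [hφ.derivSymb_apply, hξ]
  simp

lemma norm_derivSymb_le (hφ : LPFunction φ) (i : Fin n) (j : ℤ) (f : 𝓢(Ell n, ℂ)) (ξ : Ell n) :
    ‖derivSymb φ i j f ξ‖ ≤ 2 * Real.pi * (8 / 3) * (2 : ℝ) ^ j * ‖symb φ j ξ * 𝓕 f ξ‖ := by
  rw [hφ.derivSymb_apply]
  by_cases h : symb φ j ξ = 0
  · simp [h]
  · have h1 := (hφ.bounds_of_symb_ne_zero h).2
    have h2 : ‖(inner ℝ ξ (eVec n i) : ℝ)‖ ≤ 8 / 3 * (2 : ℝ) ^ j := by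
      refine (norm_inner_le_norm _ _).trans ?_
      simpa [eVec] using h1
    rw [norm_mul, norm_mul, norm_mul, norm_mul, Complex.norm_real, Complex.norm_I,
      Complex.norm_real, Real.norm_of_nonneg Real.pi_pos.le, Complex.norm_two, mul_one]
    calc 2 * Real.pi * (‖(inner ℝ ξ (eVec n i) : ℝ)‖ * ‖symb φ j ξ * 𝓕 f ξ‖)
        ≤ 2 * Real.pi * (8 / 3 * (2 : ℝ) ^ j * ‖symb φ j ξ * 𝓕 f ξ‖) := by gcongr
      _ = _ := by ring

lemma pd_deltaJ (hφ : LPFunction φ) (i : Fin n) (j : ℤ) (f : 𝓢(Ell n, ℂ)) :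
    pd i (DeltaJ φ j f) = ⇑(𝓕⁻ (derivSymb φ i j f) : 𝓢(Ell n, ℂ)) := by
  ext x
  rw [pd, hφ.deltaJ_eq, ← lineDerivOp_apply_eq_fderiv, lineDerivOp_fourierInv_eq]
  rfl

lemma pd_deltaJ_deltaJ (hφ : LPFunction φ) (i : Fin n) (j k : ℤ) (f : 𝓢(Ell n, ℂ)) :
    pd i (DeltaJ φ k (DeltaJ φ j f)) =
      ⇑(𝓕⁻ (smulLeftCLM ℂ (symb φ k) (derivSymb φ i j f)) : 𝓢(Ell n, ℂ)) := by
  rw [hφ.deltaJ_eq j, hφ.pd_deltaJ]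
  congr 2
  ext ξ
  rw [smulLeftCLM_apply_apply (hφ.hasTemperateGrowth_symb k), hφ.derivSymb_apply,
    hφ.derivSymb_apply, FourierTransform.fourier_fourierInv_eq,
    smulLeftCLM_apply_apply (hφ.hasTemperateGrowth_symb j), smul_eq_mul, smul_eq_mul]
  ring

/-! ### Low-frequency cut-offs -/

/-- The Fourier transform of `Ṡ_j f`. -/
def lowFreq (φ : Ell n → ℝ) (j : ℤ) (f : 𝓢(Ell n, ℂ)) (ξ : Ell n) : ℂ :=
  ∑' j' : ℤ, if j' ≤ j - 1 then symb φ j' ξ * 𝓕 f ξ else 0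

lemma norm_lowFreq_le (hφ : LPFunction φ) (j : ℤ) (f : 𝓢(Ell n, ℂ)) (ξ : Ell n) :
    ‖lowFreq φ j f ξ‖ ≤ ‖𝓕 f ξ‖ := by
  have hs := (hφ.summable_norm_symb ξ).mul_right ‖𝓕 f ξ‖
  refine (tsum_of_norm_bounded hs.hasSum fun j' => ?_).trans ?_
  · split_ifs
    · rw [norm_mul]
    · rw [norm_zero]
      positivity
  · rw [tsum_mul_right]
    exact mul_le_of_le_one_left (norm_nonneg _) (hφ.tsum_norm_symb_le ξ)

lemma norm_le_of_lowFreq_ne_zero (hφ : LPFunction φ) {j : ℤ} {f : 𝓢(Ell n, ℂ)} {ξ : Ell n}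
    (h : lowFreq φ j f ξ ≠ 0) : ‖ξ‖ ≤ 8 / 3 * (2 : ℝ) ^ (j - 1) := by
  contrapose! h
  refine (tsum_congr fun j' => ?_).trans tsum_zero
  split_ifs with hj
  · have : symb φ j' ξ = 0 := by
      by_contra h0
      have h1 := (hφ.bounds_of_symb_ne_zero h0).2
      have h2 : (2 : ℝ) ^ j' ≤ 2 ^ (j - 1) := zpow_le_zpow_right₀ (by norm_num) hj
      linarith
    rw [this, zero_mul]
  · rfl

lemma hasCompactSupport_lowFreq (hφ : LPFunction φ) (j : ℤ) (f : 𝓢(Ell n, ℂ)) :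
    HasCompactSupport (lowFreq φ j f) := by
  refine HasCompactSupport.intro
    (isCompact_closedBall (0 : Ell n) (8 / 3 * (2 : ℝ) ^ (j - 1))) ?_
  intro ξ hξ
  by_contra h
  exact hξ (by simpa using hφ.norm_le_of_lowFreq_ne_zero h)

lemma measurable_symb (hφ : LPFunction φ) (j : ℤ) : Measurable (symb φ j) :=
  (hφ.contDiff_symb j).continuous.measurable

lemma integrable_lowFreq (hφ : LPFunction φ) (j : ℤ) (f : 𝓢(Ell n, ℂ)) :
    Integrable (lowFreq φ j f) := by
  refine (𝓕 f).integrable.mono ?_ (Eventually.of_forall (hφ.norm_lowFreq_le j f))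
  refine Measurable.aestronglyMeasurable (Measurable.tsum fun j' => ?_)
  split_ifs
  · exact (hφ.measurable_symb j').mul (𝓕 f).continuous.measurable
  · exact measurable_const

lemma sJ_eq (hφ : LPFunction φ) (j : ℤ) (f : 𝓢(Ell n, ℂ)) :
    SJ φ j f = 𝓕⁻ (lowFreq φ j f) := by
  ext x
  rw [SJ, Real.fourierInv_eq]
  have hF : ∀ j' : ℤ, (if j' ≤ j - 1 then DeltaJ φ j' f x else 0) =
      ∫ ξ, (Real.fourierChar (inner ℝ ξ x)) • (if j' ≤ j - 1 then symb φ j' ξ * 𝓕 f ξ else 0) := by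
    intro j'
    split_ifs
    · rw [DeltaJ, Real.fourierInv_eq]
      rfl
    · simp
  simp_rw [hF]
  refine HasSum.tsum_eq ?_
  refine hasSum_integral_of_dominated_convergence
    (fun j' ξ => ‖symb φ j' ξ‖ * ‖𝓕 f ξ‖) ?_ ?_ ?_ ?_ ?_
  · intro j'
    refine Continuous.aestronglyMeasurable ?_
    have := (hφ.contDiff_symb j').continuous
    have := (𝓕 f).continuous
    split_ifs <;> fun_prop
  · intro j'
    refine Eventually.of_forall fun ξ => ?_
    rw [Circle.norm_smul]
    split_ifs
    · rw [norm_mul]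
    · rw [norm_zero]
      positivity
  · exact Eventually.of_forall fun ξ => (hφ.summable_norm_symb ξ).mul_right _
  · refine (𝓕 f).integrable.mono ?_ (Eventually.of_forall fun ξ => ?_)
    · exact Measurable.aestronglyMeasurable (Measurable.tsum fun j' =>
        (hφ.measurable_symb j').norm.mul (𝓕 f).continuous.measurable.norm)
    · rw [tsum_mul_right, norm_mul, norm_norm]
      refine mul_le_of_le_one_left (norm_nonneg _) ?_
      rw [Real.norm_of_nonneg (tsum_nonneg fun _ => norm_nonneg _)]
      exact hφ.tsum_norm_symb_le ξ
  · refine Eventually.of_forall fun ξ => ?_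
    refine HasSum.const_smul _ (Summable.hasSum ?_)
    refine Summable.of_norm_bounded ((hφ.summable_norm_symb ξ).mul_right ‖𝓕 f ξ‖) fun j' => ?_
    split_ifs
    · rw [norm_mul]
    · rw [norm_zero]
      positivity

/-! ### The commutator on the Fourier side -/

lemma integrable_mul_comp_sub {a : Ell n → ℂ} (ha : Integrable a) (b : 𝓢(Ell n, ℂ))
    (ξ : Ell n) : Integrable fun η => a η * b (ξ - η) := by
  have hb : Continuous fun η => b (ξ - η) := b.continuous.comp (continuous_sub_left ξ)
  refine ha.mul_bdd (c := SchwartzMap.seminorm ℝ 0 0 b) hb.aestronglyMeasurable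
    (Eventually.of_forall fun η => ?_)
  exact b.norm_le_seminorm ℝ (ξ - η)

lemma exists_fourierInv_commutator (hφ : LPFunction φ) (j k : ℤ) (F : Fin n → 𝓢(Ell n, ℂ))
    (g : 𝓢(Ell n, ℂ)) :
    ∃ G : 𝓢(Ell n, ℂ),
      (∀ x, DeltaJ φ k (fun y => ∑ i, SJ φ (j - 1) (F i) y * pd i (DeltaJ φ j g) y) x
        - ∑ i, SJ φ (j - 1) (F i) x * pd i (DeltaJ φ k (DeltaJ φ j g)) x
          = (𝓕⁻ G : 𝓢(Ell n, ℂ)) x) ∧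
      ∀ ξ, G ξ = ∑ i, ∫ η, lowFreq φ (j - 1) (F i) η *
        ((symb φ k ξ - symb φ k (ξ - η)) * derivSymb φ i j g (ξ - η)) := by
  have hcs : ∀ i, HasCompactSupport (smulLeftCLM ℂ (symb φ k) (derivSymb φ i j g)) := by
    intro i
    refine (hφ.hasCompactSupport_symb k).mono fun ξ hξ => ?_
    rw [Function.mem_support] at hξ ⊢
    contrapose! hξ
    rw [smulLeftCLM_apply_apply (hφ.hasTemperateGrowth_symb k), hξ, zero_smul]
  choose A hA hA' using fun i => exists_schwartz_fourierInv_mul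
    (hφ.integrable_lowFreq (j - 1) (F i)) (hφ.hasCompactSupport_lowFreq (j - 1) (F i))
    (derivSymb φ i j g) (hφ.hasCompactSupport_derivSymb i j g)
  choose B hB hB' using fun i => exists_schwartz_fourierInv_mul
    (hφ.integrable_lowFreq (j - 1) (F i)) (hφ.hasCompactSupport_lowFreq (j - 1) (F i))
    (smulLeftCLM ℂ (symb φ k) (derivSymb φ i j g)) (hcs i)
  refine ⟨smulLeftCLM ℂ (symb φ k) (∑ i, A i) - ∑ i, B i, fun x => ?_, fun ξ => ?_⟩
  · have h1 : (fun y => ∑ i, SJ φ (j - 1) (F i) y * pd i (DeltaJ φ j g) y) =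
        ⇑(𝓕⁻ (∑ i, A i) : 𝓢(Ell n, ℂ)) := by
      ext y
      rw [FourierTransform.fourierInv_sum, sum_apply]
      refine Finset.sum_congr rfl fun i _ => ?_
      rw [hφ.sJ_eq, hφ.pd_deltaJ]
      exact (hA' i y).symm
    have h2 : ∑ i, SJ φ (j - 1) (F i) x * pd i (DeltaJ φ k (DeltaJ φ j g)) x =
        (𝓕⁻ (∑ i, B i) : 𝓢(Ell n, ℂ)) x := by
      rw [FourierTransform.fourierInv_sum, sum_apply]
      refine Finset.sum_congr rfl fun i _ => ?_
      rw [hφ.sJ_eq, hφ.pd_deltaJ_deltaJ]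
      exact (hB' i x).symm
    rw [h1, h2, hφ.deltaJ_eq, FourierTransform.fourier_fourierInv_eq,
      sub_eq_add_neg, sub_eq_add_neg, FourierTransform.fourierInv_add,
      FourierTransform.fourierInv_neg, add_apply, neg_apply]
  · rw [sub_apply, smulLeftCLM_apply_apply (hφ.hasTemperateGrowth_symb k), sum_apply, sum_apply,
      smul_eq_mul, Finset.mul_sum, ← Finset.sum_sub_distrib]
    refine Finset.sum_congr rfl fun i _ => ?_
    have hi := hφ.integrable_lowFreq (j - 1) (F i)
    rw [hA, hB, ← integral_const_mul, ← integral_sub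
      ((integrable_mul_comp_sub hi _ ξ).const_mul _) (integrable_mul_comp_sub hi _ ξ)]
    refine integral_congr_ae (Eventually.of_forall fun η => ?_)
    simp only
    rw [smulLeftCLM_apply_apply (hφ.hasTemperateGrowth_symb k), smul_eq_mul]
    ring

lemma commutator_integrand_eq_zero (hφ : LPFunction φ) {j k : ℤ} (hjk : 5 < |j - k|)
    (f g : 𝓢(Ell n, ℂ)) (i : Fin n) (ξ η : Ell n) :
    lowFreq φ (j - 1) f η *
        ((symb φ k ξ - symb φ k (ξ - η)) * derivSymb φ i j g (ξ - η)) = 0 := by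
  by_cases ha : lowFreq φ (j - 1) f η = 0
  · rw [ha, zero_mul]
  by_cases hb : symb φ j (ξ - η) = 0
  · rw [hφ.derivSymb_apply, hb]
    simp
  have hk0 : symb φ k (ξ - η) = 0 :=
    (mul_eq_zero.1 (hφ.symb_mul_symb_eq_zero (j := j) (k := k) (by linarith) (ξ - η))).resolve_left
      hb
  have hk1 : symb φ k ξ = 0 := by
    by_contra hk
    have h1 := hφ.norm_le_of_lowFreq_ne_zero ha
    obtain ⟨h2, h3⟩ := hφ.bounds_of_symb_ne_zero hb
    obtain ⟨h4, h5⟩ := hφ.bounds_of_symb_ne_zero hk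
    have h6 : ‖ξ‖ ≤ ‖ξ - η‖ + ‖η‖ := by simpa using norm_add_le (ξ - η) η
    have h7 : ‖ξ - η‖ ≤ ‖ξ‖ + ‖η‖ := norm_sub_le _ _
    have h8 : (2 : ℝ) ^ (j - 1 - 1) = 2 ^ j / 4 := by
      rw [zpow_sub₀ two_ne_zero, zpow_sub₀ two_ne_zero]
      norm_num
      ring
    have hj : (0 : ℝ) < 2 ^ j := by positivity
    have hk' : (0 : ℝ) < 2 ^ k := by positivity
    rw [h8] at h1
    rcases lt_abs.1 hjk with h | h
    · have : (2 : ℝ) ^ (k + 6) ≤ 2 ^ j := zpow_le_zpow_right₀ (by norm_num) (by linarith)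
      rw [zpow_add₀ two_ne_zero] at this
      norm_num at this
      linarith
    · have : (2 : ℝ) ^ (j + 6) ≤ 2 ^ k := zpow_le_zpow_right₀ (by norm_num) (by linarith)
      rw [zpow_add₀ two_ne_zero] at this
      norm_num at this
      linarith
  rw [hk0, hk1]
  simp

/-- The Fourier transform of `Δ_j f`. -/
abbrev block (φ : Ell n → ℝ) (j : ℤ) (f : 𝓢(Ell n, ℂ)) : 𝓢(Ell n, ℂ) :=
  smulLeftCLM ℂ (symb φ j) (𝓕 f)

lemma block_apply (hφ : LPFunction φ) (j : ℤ) (f : 𝓢(Ell n, ℂ)) (ξ : Ell n) :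
    block φ j f ξ = symb φ j ξ * 𝓕 f ξ := by
  rw [smulLeftCLM_apply_apply (hφ.hasTemperateGrowth_symb j), smul_eq_mul]

lemma schwartzL2_commutator_le (hφ : LPFunction φ) {L : ℝ} (hL0 : 0 ≤ L)
    (hL : ∀ (k : ℤ) (ξ η : Ell n),
      ‖symb φ k ξ - symb φ k (ξ - η)‖ ≤ L * (2 : ℝ) ^ (-k) * ‖η‖)
    (j k : ℤ) (F : Fin n → 𝓢(Ell n, ℂ)) (g G : 𝓢(Ell n, ℂ)) {M : ℝ} (hM : 0 ≤ M)
    (hFM : ∫⁻ η, ∑ i, ‖η‖ₑ * ‖𝓕 (F i) η‖ₑ ≤ ENNReal.ofReal M)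
    (hG : ∀ ξ, G ξ = ∑ i, ∫ η, lowFreq φ (j - 1) (F i) η *
        ((symb φ k ξ - symb φ k (ξ - η)) * derivSymb φ i j g (ξ - η))) :
    schwartzL2 G ≤ L * (2 : ℝ) ^ (-k) * (2 * Real.pi * (8 / 3) * (2 : ℝ) ^ j) * M
      * schwartzL2 (block φ j g) := by
  have hmeas : ∀ i, Measurable fun η : Ell n => ‖η‖ₑ * ‖𝓕 (F i) η‖ₑ := fun i =>
    (continuous_enorm.measurable).mul (𝓕 (F i)).continuous.enorm.measurable
  refine schwartzL2_le_of_norm_le_conv (Finset.measurable_fun_sum _ fun i _ => hmeas i)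
    (by positivity) hM hFM fun ξ => ?_
  have hvm : Measurable fun η => ‖block φ j g (ξ - η)‖ₑ :=
    ((block φ j g).continuous.comp (continuous_sub_left ξ)).enorm.measurable
  calc ‖G ξ‖ₑ ≤ ∑ i, ∫⁻ η, ‖lowFreq φ (j - 1) (F i) η *
        ((symb φ k ξ - symb φ k (ξ - η)) * derivSymb φ i j g (ξ - η))‖ₑ := by
        rw [hG]
        refine (enorm_sum_le _ _).trans (Finset.sum_le_sum fun i _ => ?_)
        exact enorm_integral_le_lintegral_enorm _
    _ ≤ ∑ i, ∫⁻ η, ENNReal.ofReal (L * (2 : ℝ) ^ (-k) * (2 * Real.pi * (8 / 3) * (2 : ℝ) ^ j)) *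
          ((‖η‖ₑ * ‖𝓕 (F i) η‖ₑ) * ‖block φ j g (ξ - η)‖ₑ) := by
        refine Finset.sum_le_sum fun i _ => lintegral_mono fun η => ?_
        simp only [← ofReal_norm]
        rw [← ENNReal.ofReal_mul (norm_nonneg _), ← ENNReal.ofReal_mul (by positivity),
          ← ENNReal.ofReal_mul (by positivity)]
        refine ENNReal.ofReal_le_ofReal ?_
        rw [norm_mul, norm_mul, hφ.block_apply]
        calc _ ≤ ‖𝓕 (F i) η‖ * ((L * (2 : ℝ) ^ (-k) * ‖η‖) *
              (2 * Real.pi * (8 / 3) * (2 : ℝ) ^ j * ‖symb φ j (ξ - η) * 𝓕 g (ξ - η)‖)) := by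
              gcongr
              · exact hφ.norm_lowFreq_le _ _ _
              · exact hL k ξ η
              · exact hφ.norm_derivSymb_le i j g (ξ - η)
          _ = _ := by ring
    _ = _ := by
        rw [← lintegral_finsetSum, ← lintegral_const_mul]
        · refine lintegral_congr fun η => ?_
          rw [Finset.sum_mul, Finset.mul_sum]
        · exact (Finset.measurable_fun_sum _ fun i _ => hmeas i).mul hvm
        · exact fun i _ => ((hmeas i).mul hvm).const_mul _

/-! ### Besov bounds -/

/-- The constant in the Bernstein inequality
`∫ |η| |φ(2^{-j}η) 𝓕f(η)| dη ≤ C 2^{j(n/2+1)} ‖Δ_j f‖`. -/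
def bernsteinConst (n : ℕ) : ℝ :=
  8 / 3 * Real.sqrt ((8 / 3) ^ n * (volume (Metric.ball (0 : Ell n) 1)).toReal)

lemma bernsteinConst_nonneg (n : ℕ) : 0 ≤ bernsteinConst n := by
  unfold bernsteinConst
  positivity

lemma lintegral_enorm_mul_block_le (hφ : LPFunction φ) (j : ℤ) (f : 𝓢(Ell n, ℂ)) :
    ∫⁻ η, ‖η‖ₑ * ‖block φ j f η‖ₑ ≤ ENNReal.ofReal (bernsteinConst n *
      ((2 : ℝ) ^ ((j : ℝ) * ((n : ℝ) / 2 + 1)) * schwartzL2 (block φ j f))) := by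
  set V : ℝ := (volume (Metric.ball (0 : Ell n) 1)).toReal with hV
  set r : ℝ := 8 / 3 * (2 : ℝ) ^ j with hr
  have hr0 : 0 ≤ r := by positivity
  set B : Set (Ell n) := Metric.closedBall 0 r with hB
  have hBm : MeasurableSet B := Metric.isClosed_closedBall.measurableSet
  set w : Ell n → ENNReal := B.indicator 1 with hw
  have hwm : Measurable w := measurable_one.indicator hBm
  have hvm : Measurable fun η => ‖block φ j f η‖ₑ := (block φ j f).continuous.enorm.measurable
  have hvol : ∫⁻ η, w η = ENNReal.ofReal (r ^ n * V) := by
    rw [hw, lintegral_indicator_one hBm, hB, Measure.addHaar_closedBall _ _ hr0,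
      finrank_euclideanSpace_fin, ENNReal.ofReal_mul (by positivity), hV,
      ENNReal.ofReal_toReal measure_ball_lt_top.ne]
  have hCS : ∫⁻ η, w η * ‖block φ j f η‖ₑ ≤
      ENNReal.ofReal (Real.sqrt (r ^ n * V) * schwartzL2 (block φ j f)) := by
    rw [← ENNReal.pow_le_pow_left_iff two_ne_zero]
    refine (sq_lintegral_mul_le volume hwm.aemeasurable hvm.aemeasurable).trans ?_
    rw [hvol, ENNReal.ofReal_mul (Real.sqrt_nonneg _), mul_pow (ENNReal.ofReal _) _ 2,
      ← ENNReal.ofReal_pow (Real.sqrt_nonneg _), Real.sq_sqrt (by positivity),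
      ← lintegral_enorm_sq_eq_schwartzL2]
    gcongr with η
    refine mul_le_of_le_one_left' ?_
    exact Set.indicator_le_self' (fun _ _ => zero_le) η
  have hpt : ∀ η, ‖η‖ₑ * ‖block φ j f η‖ₑ ≤ ENNReal.ofReal r * (w η * ‖block φ j f η‖ₑ) := by
    intro η
    by_cases h : symb φ j η = 0
    · simp [hφ.block_apply, h]
    · have h1 := (hφ.bounds_of_symb_ne_zero h).2
      have h2 : w η = 1 := Set.indicator_of_mem (by simpa [hB] using h1) _
      rw [h2, one_mul, ← ofReal_norm]
      gcongr
  calc ∫⁻ η, ‖η‖ₑ * ‖block φ j f η‖ₑ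
      ≤ ∫⁻ η, ENNReal.ofReal r * (w η * ‖block φ j f η‖ₑ) := lintegral_mono hpt
    _ = ENNReal.ofReal r * ∫⁻ η, w η * ‖block φ j f η‖ₑ := lintegral_const_mul _ (hwm.mul hvm)
    _ ≤ ENNReal.ofReal r *
        ENNReal.ofReal (Real.sqrt (r ^ n * V) * schwartzL2 (block φ j f)) := by gcongr
    _ = _ := by
      rw [← ENNReal.ofReal_mul hr0]
      congr 1
      have h1 : Real.sqrt (r ^ n * V) =
          Real.sqrt ((8 / 3) ^ n * V) * (2 : ℝ) ^ ((j : ℝ) * ((n : ℝ) / 2)) := by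
        rw [hr, mul_pow, mul_right_comm, Real.sqrt_mul (by positivity)]
        congr 1
        rw [Real.sqrt_eq_rpow, ← Real.rpow_intCast, ← Real.rpow_natCast, ← Real.rpow_mul two_pos.le,
          ← Real.rpow_mul two_pos.le]
        congr 1
        ring
      have h2 : (2 : ℝ) ^ ((j : ℝ) * ((n : ℝ) / 2 + 1)) =
          (2 : ℝ) ^ ((j : ℝ) * ((n : ℝ) / 2)) * 2 ^ j := by
        rw [mul_add, Real.rpow_add two_pos, mul_one, Real.rpow_intCast]
      rw [h1, h2, bernsteinConst, hr, ← hV]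
      ring

lemma lintegral_enorm_mul_fourier_le (hφ : LPFunction φ) (f : 𝓢(Ell n, ℂ)) :
    ∫⁻ η, ‖η‖ₑ * ‖𝓕 f η‖ₑ ≤ ∑' j : ℤ, ENNReal.ofReal (bernsteinConst n *
      ((2 : ℝ) ^ ((j : ℝ) * ((n : ℝ) / 2 + 1)) * schwartzL2 (block φ j f))) := by
  calc ∫⁻ η, ‖η‖ₑ * ‖𝓕 f η‖ₑ
      ≤ ∫⁻ η, ∑' j : ℤ, ‖η‖ₑ * ‖block φ j f η‖ₑ := by
        refine lintegral_mono fun η => ?_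
        by_cases h0 : η = 0
        · simp [h0]
        have h1 : ∑' j : ℤ, ‖symb φ j η‖ₑ = 1 := by
          simp_rw [← ofReal_norm]
          rw [← ENNReal.ofReal_tsum_of_nonneg (fun _ => norm_nonneg _) (hφ.summable_norm_symb η),
            hφ.tsum_norm_symb h0, ENNReal.ofReal_one]
        simp only [hφ.block_apply, enorm_mul]
        rw [ENNReal.tsum_mul_left, ENNReal.tsum_mul_right, h1, one_mul]
    _ = ∑' j : ℤ, ∫⁻ η, ‖η‖ₑ * ‖block φ j f η‖ₑ := by
        refine lintegral_tsum fun j => Measurable.aemeasurable ?_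
        exact continuous_enorm.measurable.mul (block φ j f).continuous.enorm.measurable
    _ ≤ _ := ENNReal.tsum_le_tsum fun j => hφ.lintegral_enorm_mul_block_le j f

lemma schwartzL2_block_le (hφ : LPFunction φ) (j : ℤ) (f : 𝓢(Ell n, ℂ)) :
    schwartzL2 (block φ j f) ≤ schwartzL2 (𝓕 f) := by
  rw [← one_mul (schwartzL2 (𝓕 f))]
  refine schwartzL2_le_of_norm_le fun ξ => ?_
  rw [hφ.block_apply, norm_mul]
  gcongr
  exact hφ.norm_symb_le_one j ξ

lemma schwartzL2_block_le_of_decay (hφ : LPFunction φ) (N : ℕ) (j : ℤ) (f : 𝓢(Ell n, ℂ)) :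
    schwartzL2 (block φ j f) ≤ (4 / 3 * (2 : ℝ) ^ (-j)) ^ (2 * N) *
      schwartzL2 (smulLeftCLM ℂ (fun ξ : Ell n => (‖ξ‖ ^ 2) ^ N) (𝓕 f)) := by
  refine schwartzL2_le_of_norm_le fun ξ => ?_
  have ht : (fun ξ : Ell n => (‖ξ‖ ^ 2) ^ N).HasTemperateGrowth :=
    (Function.hasTemperateGrowth_norm_sq (Ell n)).pow N
  rw [hφ.block_apply, smulLeftCLM_apply_apply ht, norm_smul, Real.norm_of_nonneg (by positivity),
    ← mul_assoc, ← pow_mul, ← mul_pow, norm_mul]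
  gcongr
  by_cases h : symb φ j ξ = 0
  · rw [h, norm_zero]
    positivity
  · refine (hφ.norm_symb_le_one j ξ).trans (one_le_pow₀ ?_)
    have h1 := (hφ.bounds_of_symb_ne_zero h).1
    have hj : (0 : ℝ) < 2 ^ j := by positivity
    rw [zpow_neg, ← div_eq_mul_inv, div_mul_eq_mul_div, le_div_iff₀ hj]
    linarith

lemma summable_rpow_mul_schwartzL2_block (hφ : LPFunction φ) {s : ℝ} (hs : 0 < s)
    (f : 𝓢(Ell n, ℂ)) :
    Summable fun j : ℤ => (2 : ℝ) ^ ((j : ℝ) * s) * schwartzL2 (block φ j f) := by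
  obtain ⟨N, hN⟩ := exists_nat_gt s
  rw [summable_int_iff_summable_nat_and_neg]
  constructor
  · set H := schwartzL2 (smulLeftCLM ℂ (fun ξ : Ell n => (‖ξ‖ ^ 2) ^ N) (𝓕 f))
    have hg : Summable fun m : ℕ => ((4 / 3 : ℝ) ^ (2 * N) * H) * ((2 : ℝ) ^ (s - 2 * N)) ^ m := by
      refine (summable_geometric_of_lt_one (by positivity) ?_).mul_left _
      refine Real.rpow_lt_one_of_one_lt_of_neg (by norm_num) ?_
      have : (0 : ℝ) ≤ N := Nat.cast_nonneg N
      linarith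
    refine hg.of_nonneg_of_le (fun m => by positivity) fun m => ?_
    have h1 := hφ.schwartzL2_block_le_of_decay N m f
    have h2 : (2 : ℝ) ^ (((m : ℤ) : ℝ) * s) * ((2 : ℝ) ^ (-(m : ℤ))) ^ (2 * N) =
        ((2 : ℝ) ^ (s - 2 * N)) ^ m := by
      rw [← Real.rpow_intCast, ← Real.rpow_natCast, ← Real.rpow_natCast, ← Real.rpow_mul two_pos.le,
        ← Real.rpow_mul two_pos.le, ← Real.rpow_add two_pos]
      congr 1
      push_cast
      ring
    calc _ ≤ (2 : ℝ) ^ (((m : ℤ) : ℝ) * s) * ((4 / 3 * (2 : ℝ) ^ (-(m : ℤ))) ^ (2 * N) * H) := by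
          gcongr
      _ = ((4 / 3 : ℝ) ^ (2 * N) * H) *
          ((2 : ℝ) ^ (((m : ℤ) : ℝ) * s) * ((2 : ℝ) ^ (-(m : ℤ))) ^ (2 * N)) := by
          rw [mul_pow]
          ring
      _ = _ := by rw [h2]
  · have hg : Summable fun m : ℕ => schwartzL2 (𝓕 f) * ((2 : ℝ) ^ (-s)) ^ m := by
      refine (summable_geometric_of_lt_one (by positivity) ?_).mul_left _
      exact Real.rpow_lt_one_of_one_lt_of_neg (by norm_num) (by linarith)
    refine hg.of_nonneg_of_le (fun m => by positivity) fun m => ?_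
    have h2 : (2 : ℝ) ^ (((-(m : ℤ) : ℤ) : ℝ) * s) = ((2 : ℝ) ^ (-s)) ^ m := by
      rw [← Real.rpow_natCast, ← Real.rpow_mul two_pos.le]
      congr 1
      push_cast
      ring
    rw [h2, mul_comm]
    gcongr
    exact hφ.schwartzL2_block_le _ f

/-- The complexification of a real-valued Schwartz function. -/
def complexify (f : 𝓢(Ell n, ℝ)) : 𝓢(Ell n, ℂ) := postcompCLM Complex.ofRealCLM f

lemma cf_eq_complexify (f : 𝓢(Ell n, ℝ)) : cf f = complexify f := rfl

lemma integral_norm_sq_deltaJ (hφ : LPFunction φ) (j : ℤ) (f : 𝓢(Ell n, ℂ)) :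
    ∫ x, ‖DeltaJ φ j f x‖ ^ 2 = schwartzL2 (block φ j f) ^ 2 := by
  rw [← schwartzL2_fourierInv, ← sqrt_integral_norm_sq_eq_schwartzL2,
    Real.sq_sqrt (by positivity), hφ.deltaJ_eq]

lemma deltaL2_eq (hφ : LPFunction φ) (j : ℤ) (u : Fin n → 𝓢(Ell n, ℝ)) :
    DeltaL2 φ j (fun l x => u l x) =
      Real.sqrt (∑ l, schwartzL2 (block φ j (complexify (u l))) ^ 2) := by
  rw [DeltaL2]
  congr 1
  exact Finset.sum_congr rfl fun l _ => hφ.integral_norm_sq_deltaJ j (complexify (u l))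

lemma schwartzL2_block_le_deltaL2 (hφ : LPFunction φ) (j : ℤ) (u : Fin n → 𝓢(Ell n, ℝ))
    (l : Fin n) :
    schwartzL2 (block φ j (complexify (u l))) ≤ DeltaL2 φ j (fun l x => u l x) := by
  rw [hφ.deltaL2_eq]
  refine Real.le_sqrt_of_sq_le ?_
  exact Finset.single_le_sum (f := fun l => schwartzL2 (block φ j (complexify (u l))) ^ 2)
    (fun _ _ => by positivity) (Finset.mem_univ l)

lemma deltaL2_le_sum (hφ : LPFunction φ) (j : ℤ) (u : Fin n → 𝓢(Ell n, ℝ)) :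
    DeltaL2 φ j (fun l x => u l x) ≤ ∑ l, schwartzL2 (block φ j (complexify (u l))) := by
  rw [hφ.deltaL2_eq]
  refine Real.sqrt_le_iff.2 ⟨by positivity, ?_⟩
  exact Finset.sum_sq_le_sq_sum_of_nonneg fun _ _ => norm_nonneg _

lemma summable_besov (hφ : LPFunction φ) {s : ℝ} (hs : 0 < s) (u : Fin n → 𝓢(Ell n, ℝ)) :
    Summable fun j : ℤ => (2 : ℝ) ^ ((j : ℝ) * s) * DeltaL2 φ j (fun l x => u l x) := by
  have h : Summable fun j : ℤ =>
      ∑ l, (2 : ℝ) ^ ((j : ℝ) * s) * schwartzL2 (block φ j (complexify (u l))) :=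
    summable_sum fun l _ => hφ.summable_rpow_mul_schwartzL2_block hs _
  refine h.of_nonneg_of_le (fun j => mul_nonneg (by positivity) (Real.sqrt_nonneg _)) fun j => ?_
  rw [← Finset.mul_sum]
  gcongr
  exact hφ.deltaL2_le_sum j u

lemma lintegral_sum_enorm_mul_fourier_le (hφ : LPFunction φ) (u : Fin n → 𝓢(Ell n, ℝ)) :
    ∫⁻ η, ∑ i, ‖η‖ₑ * ‖𝓕 (complexify (u i)) η‖ₑ ≤
      ENNReal.ofReal (n * (bernsteinConst n *
        Bnorm φ ((n : ℝ) / 2 + 1) (fun l x => u l x))) := by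
  have hK := bernsteinConst_nonneg n
  have hmeas : ∀ i, Measurable fun η : Ell n => ‖η‖ₑ * ‖𝓕 (complexify (u i)) η‖ₑ := fun i =>
    continuous_enorm.measurable.mul (𝓕 (complexify (u i))).continuous.enorm.measurable
  rw [lintegral_finsetSum _ fun i _ => hmeas i]
  refine (Finset.sum_le_card_nsmul _ _ (ENNReal.ofReal (bernsteinConst n *
        Bnorm φ ((n : ℝ) / 2 + 1) (fun l x => u l x))) fun i _ => ?_).trans ?_
  · refine (hφ.lintegral_enorm_mul_fourier_le _).trans ?_
    have hnn : ∀ j : ℤ, 0 ≤ bernsteinConst n * ((2 : ℝ) ^ ((j : ℝ) * ((n : ℝ) / 2 + 1)) *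
        DeltaL2 φ j (fun l x => u l x)) := fun j =>
      mul_nonneg hK (mul_nonneg (by positivity) (Real.sqrt_nonneg _))
    rw [Bnorm, ← tsum_mul_left, ENNReal.ofReal_tsum_of_nonneg hnn
      ((hφ.summable_besov (by positivity) u).mul_left _)]
    refine ENNReal.tsum_le_tsum fun j => ENNReal.ofReal_le_ofReal ?_
    gcongr
    exact hφ.schwartzL2_block_le_deltaL2 j u i
  · rw [Finset.card_univ, Fintype.card_fin, nsmul_eq_mul, ENNReal.ofReal_mul n.cast_nonneg,
      ENNReal.ofReal_natCast]

end LPFunction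

/-- A summable nonnegative sequence yields a normalised sequence controlling its local sums. -/
lemma exists_tsum_eq_one_sum_shift_le {e : ℤ → ℝ} (he : ∀ k, 0 ≤ e k) (hs : Summable e)
    {S : Finset ℤ} (hS : S.Nonempty) :
    ∃ d : ℤ → ℝ, (∀ k, 0 ≤ d k) ∧ ∑' k, d k = 1 ∧
      ∀ k, ∑ m ∈ S, e (k + m) ≤ S.card * d k * ∑' j, e j := by
  have hcard : (0 : ℝ) < S.card := by exact_mod_cast hS.card_pos
  rcases (tsum_nonneg he).eq_or_lt with h0 | h0
  · refine ⟨Pi.single 0 1, fun k => ?_, tsum_pi_single 0 1, fun k => ?_⟩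
    · by_cases hk : k = 0
      · simp [hk]
      · simp [hk]
    · have hz : ∀ j, e j = 0 := fun j =>
        le_antisymm ((hs.le_tsum j fun i _ => he i).trans h0.ge) (he j)
      simp [hz]
  · refine ⟨fun k => (∑ m ∈ S, e (k + m)) / (S.card * ∑' j, e j), fun k => ?_, ?_, fun k => ?_⟩
    · exact div_nonneg (Finset.sum_nonneg fun m _ => he _) (by positivity)
    · have hshift : ∀ m : ℤ, Summable fun k => e (k + m) := fun m =>
        (Equiv.addRight m).summable_iff.2 hs
      have htsum : ∀ m : ℤ, ∑' k, e (k + m) = ∑' k, e k := fun m => (Equiv.addRight m).tsum_eq e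
      rw [tsum_div_const, Summable.tsum_finsetSum fun m _ => hshift m]
      simp only [htsum, Finset.sum_const, nsmul_eq_mul]
      exact div_self (by positivity)
    · apply le_of_eq
      field_simp

namespace LPFunction

variable {n : ℕ} {φ : Ell n → ℝ}

lemma zpow_mul_le_of_abs_le {s : ℝ} (hs : 0 ≤ s) {m : ℤ} (hm : |m| ≤ 5) (k : ℤ) :
    (2 : ℝ) ^ (-k) * (2 : ℝ) ^ (k + m) ≤
      2 ^ (5 + 5 * s) * ((2 : ℝ) ^ (-(k : ℝ) * s) * (2 : ℝ) ^ (((k + m : ℤ) : ℝ) * s)) := by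
  have h1 : ((-5 : ℤ) : ℝ) ≤ m := by exact_mod_cast (abs_le.1 hm).1
  have h2 : (m : ℝ) ≤ ((5 : ℤ) : ℝ) := by exact_mod_cast (abs_le.1 hm).2
  push_cast at h1 h2
  rw [← Real.rpow_intCast, ← Real.rpow_intCast, ← Real.rpow_add two_pos, ← Real.rpow_add two_pos,
    ← Real.rpow_add two_pos]
  refine Real.rpow_le_rpow_of_exponent_le one_le_two ?_
  push_cast
  nlinarith

/-- The `L²` bound for the sum of the paraproduct commutators in terms of the neighbouring
dyadic blocks. -/
lemma sqrt_integral_tsum_commutator_le (hφ : LPFunction φ) {L : ℝ} (hL0 : 0 ≤ L)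
    (hL : ∀ (k : ℤ) (ξ η : Ell n),
      ‖symb φ k ξ - symb φ k (ξ - η)‖ ≤ L * (2 : ℝ) ^ (-k) * ‖η‖)
    (u : Fin n → 𝓢(Ell n, ℝ)) (k : ℤ) (l : Fin n) :
    Real.sqrt (∫ x, ‖∑' j : ℤ,
        (DeltaJ φ k (fun y => ∑ i, SJ φ (j - 1) (cf (u i)) y
            * pd i (DeltaJ φ j (cf (u l))) y) x
          - ∑ i, SJ φ (j - 1) (cf (u i)) x
            * pd i (DeltaJ φ k (DeltaJ φ j (cf (u l)))) x)‖ ^ 2)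
      ≤ L * (2 * Real.pi * (8 / 3)) * 2 ^ (5 + 5 * ((n : ℝ) / 2 + 1)) * (n * bernsteinConst n) *
        (2 : ℝ) ^ (-(k : ℝ) * ((n : ℝ) / 2 + 1)) *
        Bnorm φ ((n : ℝ) / 2 + 1) (fun l x => u l x) *
        ∑ m ∈ Finset.Icc (-5 : ℤ) 5, (2 : ℝ) ^ (((k + m : ℤ) : ℝ) * ((n : ℝ) / 2 + 1)) *
          DeltaL2 φ (k + m) (fun l x => u l x) := by
  set s : ℝ := (n : ℝ) / 2 + 1 with hs
  have hs0 : 0 ≤ s := by positivity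
  set X : ℝ := Bnorm φ s (fun l x => u l x) with hX
  have hX0 : 0 ≤ X := tsum_nonneg fun j => mul_nonneg (by positivity) (Real.sqrt_nonneg _)
  have hK := bernsteinConst_nonneg n
  choose G hGx hG using fun j : ℤ => hφ.exists_fourierInv_commutator j k
    (fun i => complexify (u i)) (complexify (u l))
  have hG0 : ∀ j, j ∉ (Finset.Icc (-5 : ℤ) 5).map (addLeftEmbedding k) → G j = 0 := by
    intro j hj
    have hjk : 5 < |j - k| := by
      by_contra! h
      refine hj (Finset.mem_map.2 ⟨j - k, Finset.mem_Icc.2 (abs_le.1 h), ?_⟩)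
      simp
    ext ξ
    rw [hG]
    simp [hφ.commutator_integrand_eq_zero hjk]
  have hsum : ∀ x, ∑' j : ℤ,
        (DeltaJ φ k (fun y => ∑ i, SJ φ (j - 1) (cf (u i)) y
            * pd i (DeltaJ φ j (cf (u l))) y) x
          - ∑ i, SJ φ (j - 1) (cf (u i)) x
            * pd i (DeltaJ φ k (DeltaJ φ j (cf (u l)))) x) =
      (𝓕⁻ (∑ m ∈ Finset.Icc (-5 : ℤ) 5, G (k + m)) : 𝓢(Ell n, ℂ)) x := by
    intro x
    simp only [cf_eq_complexify, hGx]
    rw [tsum_eq_sum (s := (Finset.Icc (-5 : ℤ) 5).map (addLeftEmbedding k))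
      fun j hj => by simp [hG0 j hj], Finset.sum_map]
    have hmap := map_sum (FourierTransform.fourierInvCLM ℂ 𝓢(Ell n, ℂ)) (fun m => G (k + m))
      (Finset.Icc (-5 : ℤ) 5)
    simp only [FourierTransform.fourierInvCLM_apply] at hmap
    rw [hmap, _root_.sum_apply]
    rfl
  simp_rw [hsum]
  rw [sqrt_integral_norm_sq_eq_schwartzL2, schwartzL2_fourierInv, Finset.mul_sum]
  refine (schwartzL2_sum_le _ _).trans (Finset.sum_le_sum fun m hm => ?_)
  have h1 := hφ.schwartzL2_commutator_le hL0 hL (k + m) k (fun i => complexify (u i))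
    (complexify (u l)) (G (k + m)) (by positivity) (hφ.lintegral_sum_enorm_mul_fourier_le u)
    (hG (k + m))
  have h2 := hφ.schwartzL2_block_le_deltaL2 (k + m) u l
  have h3 := zpow_mul_le_of_abs_le hs0 (abs_le.2 (Finset.mem_Icc.1 hm)) k
  have hD : 0 ≤ DeltaL2 φ (k + m) (fun l x => u l x) := Real.sqrt_nonneg _
  calc _ ≤ _ := h1
    _ ≤ L * (2 : ℝ) ^ (-k) * (2 * Real.pi * (8 / 3) * (2 : ℝ) ^ (k + m)) *
        (n * (bernsteinConst n * X)) * DeltaL2 φ (k + m) (fun l x => u l x) := by gcongr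
    _ = L * (2 * Real.pi * (8 / 3)) * (n * bernsteinConst n) * X *
        DeltaL2 φ (k + m) (fun l x => u l x) * ((2 : ℝ) ^ (-k) * (2 : ℝ) ^ (k + m)) := by ring
    _ ≤ L * (2 * Real.pi * (8 / 3)) * (n * bernsteinConst n) * X *
        DeltaL2 φ (k + m) (fun l x => u l x) * (2 ^ (5 + 5 * s) *
          ((2 : ℝ) ^ (-(k : ℝ) * s) * (2 : ℝ) ^ (((k + m : ℤ) : ℝ) * s))) := by gcongr
    _ = _ := by ring

end LPFunction

/-- **Besov commutator piece (t2).** For a divergence-free Schwartz vector field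
`u`, for each `k` and each component `l`,
`‖Σ_j [Δ_k, Σᵢ Ṡ_{j−1}uᵢ ∂ᵢ](Δ_j u_l)‖_{L²} ≤ c d_k 2^{−k(n/2+1)} ‖u‖²_{Ḃ^{n/2+1}_{2,1}}`
with `d_k ≥ 0`, `Σ_k d_k = 1`, where
`[Δ_k, Σᵢ Ṡ_{j−1}uᵢ ∂ᵢ]f = Δ_k(Σᵢ Ṡ_{j−1}uᵢ ∂ᵢf) − Σᵢ Ṡ_{j−1}uᵢ ∂ᵢ(Δ_k f)`. -/
theorem besov_piece_t2 (n : ℕ) (hn : 1 ≤ n)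
    (φ : Ell n → ℝ) (hφ : LPFunction φ) :
    ∃ c > (0 : ℝ), ∀ u : Fin n → 𝓢(Ell n, ℝ), DivFree u →
      ∃ d : ℤ → ℝ, (∀ k, 0 ≤ d k) ∧ (∑' k : ℤ, d k) = 1 ∧
        ∀ k : ℤ, ∀ l : Fin n,
          Real.sqrt (∫ x, ‖∑' j : ℤ,
              (DeltaJ φ k (fun y => ∑ i, SJ φ (j - 1) (cf (u i)) y
                  * pd i (DeltaJ φ j (cf (u l))) y) x
                - ∑ i, SJ φ (j - 1) (cf (u i)) x
                  * pd i (DeltaJ φ k (DeltaJ φ j (cf (u l)))) x)‖ ^ 2)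
            ≤ c * d k * (2 : ℝ) ^ (-(k : ℝ) * ((n : ℝ) / 2 + 1))
                * Bnorm φ ((n : ℝ) / 2 + 1) (fun l' x => u l' x) ^ 2 := by
  obtain ⟨L, hL0, hL⟩ := hφ.exists_lipschitz_symb
  set A : ℝ := L * (2 * Real.pi * (8 / 3)) * 2 ^ (5 + 5 * ((n : ℝ) / 2 + 1)) *
    (n * LPFunction.bernsteinConst n) with hA
  have hA0 : 0 ≤ A := by
    have := LPFunction.bernsteinConst_nonneg n
    positivity
  refine ⟨11 * A + 1, by positivity, fun u _ => ?_⟩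
  have he : ∀ j : ℤ, 0 ≤ (2 : ℝ) ^ ((j : ℝ) * ((n : ℝ) / 2 + 1)) *
      DeltaL2 φ j (fun l x => u l x) := fun j => mul_nonneg (by positivity) (Real.sqrt_nonneg _)
  obtain ⟨d, hd0, hd1, hd⟩ := exists_tsum_eq_one_sum_shift_le he
    (hφ.summable_besov (by positivity) u) (S := Finset.Icc (-5 : ℤ) 5) ⟨0, by simp⟩
  refine ⟨d, hd0, hd1, fun k l => ?_⟩
  have hX0 : 0 ≤ Bnorm φ ((n : ℝ) / 2 + 1) (fun l x => u l x) := tsum_nonneg he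
  have hdk : _ ≤ _ * _ * Bnorm φ ((n : ℝ) / 2 + 1) (fun l x => u l x) := hd k
  have hcard : ((Finset.Icc (-5 : ℤ) 5).card : ℝ) = 11 := by simp
  rw [hcard] at hdk
  have hk0 := hd0 k
  set X := Bnorm φ ((n : ℝ) / 2 + 1) (fun l x => u l x)
  calc _ ≤ _ := hφ.sqrt_integral_tsum_commutator_le hL0 hL u k l
    _ ≤ A * (2 : ℝ) ^ (-(k : ℝ) * ((n : ℝ) / 2 + 1)) * X * (11 * d k * X) := by gcongr
    _ = 11 * A * d k * (2 : ℝ) ^ (-(k : ℝ) * ((n : ℝ) / 2 + 1)) * X ^ 2 := by ring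
    _ ≤ _ := by
      gcongr
      linarith

end
end
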